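/- arXiv:1602.00929 — 5 statements merged into one kernel-verified Lean document; each statement's English description precedes it below -/
import Mathlib

section
/- Let p, a ∈ ℝ with p ≤ a, let C > 0 and E₁ > 0. Set K := 1/(πC) + (4 ln 2)/π + (a − p) and l_max := −K + √(K² + 1/(4E₁)). Then for every 0 < l ≤ l_max and every continuously differentiable φ : ℝ → ℝ with φ and φ' square-integrable on ℝ, one has ∫_ℝ |φ'(s)|² ds + 2C ∫_ℝ ρ(s)|φ(s)|² ds ≥ 4E₁ ∫_a^{a+l} |φ(s)|² ds. -/
open MeasureTheory Real Set

/-- The Hardy weight `ρ` centred at `p`. -/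
noncomputable def rho (p : ℝ) (s : ℝ) : ℝ := if s ≤ p then 1 / (1 + (s - p) ^ 2) else 0

/-- Cauchy–Schwarz bound for the increment of a `C¹` function. -/
theorem sq_sub_le_mul_integral_deriv_sq {φ : ℝ → ℝ} (hφ : ContDiff ℝ 1 φ) {x y : ℝ}
    (hxy : x ≤ y) : (φ y - φ x) ^ 2 ≤ (y - x) * ∫ s in x..y, (deriv φ s) ^ 2 := by
  rcases hxy.eq_or_lt with rfl | hlt
  · simp
  have hc : Continuous (deriv φ) := hφ.continuous_deriv le_rfl
  have hftc : ∫ s in x..y, deriv φ s = φ y - φ x :=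
    intervalIntegral.integral_deriv_eq_sub
      (fun s _ => (hφ.differentiable one_ne_zero).differentiableAt) (hc.intervalIntegrable _ _)
  set Δ := φ y - φ x
  have hnonneg : 0 ≤ ∫ s in x..y, ((y - x) * deriv φ s - Δ) ^ 2 :=
    intervalIntegral.integral_nonneg hxy fun s _ => sq_nonneg _
  have hexpand : ∫ s in x..y, ((y - x) * deriv φ s - Δ) ^ 2 =
      (y - x) * ((y - x) * (∫ s in x..y, (deriv φ s) ^ 2) - Δ ^ 2) := by
    have hrw : ∀ s, ((y - x) * deriv φ s - Δ) ^ 2 =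
        (y - x) ^ 2 * (deriv φ s) ^ 2 - 2 * (y - x) * Δ * deriv φ s + Δ ^ 2 := fun s => by ring
    simp_rw [hrw]
    rw [intervalIntegral.integral_add, intervalIntegral.integral_sub,
      intervalIntegral.integral_const_mul, intervalIntegral.integral_const_mul, hftc,
      intervalIntegral.integral_const, smul_eq_mul]
    · ring
    all_goals exact Continuous.intervalIntegrable (by fun_prop) _ _
  rw [hexpand] at hnonneg
  linarith [nonneg_of_mul_nonneg_right hnonneg (sub_pos.2 hlt)]

theorem add_sq_le_mul_add {x y M r A B : ℝ} (hM : 0 ≤ M) (hr : 0 ≤ r) (hA : 0 ≤ A) (hB : 0 ≤ B)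
    (hx : x ^ 2 ≤ M * A) (hy : y ^ 2 ≤ r * B) : (x + y) ^ 2 ≤ (M + r) * (A + B) := by
  have hprod : x ^ 2 * y ^ 2 ≤ (M * A) * (r * B) := by gcongr
  have hsq : (2 * (x * y)) ^ 2 ≤ (M * B + r * A) ^ 2 := by
    nlinarith [sq_nonneg (M * B - r * A)]
  have h := (le_abs_self _).trans (abs_le_of_sq_le_sq hsq (by positivity))
  linarith

theorem integral_inv_one_add_sq_sub (p : ℝ) :
    ∫ t in (p - 1)..p, 1 / (1 + (t - p) ^ 2) = π / 4 := by
  rw [intervalIntegral.integral_comp_sub_right (fun t => 1 / (1 + t ^ 2)) p,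
    integral_one_div_one_add_sq]
  simp [arctan_neg]

theorem integral_sub_div_one_add_sq_sub (p : ℝ) :
    ∫ t in (p - 1)..p, (p - t) / (1 + (t - p) ^ 2) = Real.log 2 / 2 := by
  have hpos : ∀ t : ℝ, 0 < 1 + (t - p) ^ 2 := fun t => by positivity
  rw [intervalIntegral.integral_eq_sub_of_hasDerivAt
    (f := fun t => -(Real.log (1 + (t - p) ^ 2) / 2))]
  · norm_num
  · intro t _
    have hsq : HasDerivAt (fun t => 1 + (t - p) ^ 2) (2 * (t - p)) t := by
      simpa using (((hasDerivAt_id' t).sub_const p).fun_pow 2).const_add 1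
    refine ((hsq.log (hpos t).ne').div_const 2).fun_neg.congr_deriv ?_
    field_simp
    ring
  · exact Continuous.intervalIntegrable
      (Continuous.div (by fun_prop) (by fun_prop) fun t => (hpos t).ne') _ _

/-- Pointwise bound at `p` in terms of the energy on `[p - 1, p]`. -/
theorem sq_le_mul_energy {φ : ℝ → ℝ} (hφ : ContDiff ℝ 1 φ) (p : ℝ) {C : ℝ} (hC : 0 < C) :
    (φ p) ^ 2 ≤ (2 / (π * C) + 8 * Real.log 2 / π) *
      ((∫ s in (p - 1)..p, (deriv φ s) ^ 2) +
        2 * C * ∫ s in (p - 1)..p, 1 / (1 + (s - p) ^ 2) * (φ s) ^ 2) := by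
  have hc : Continuous φ := hφ.continuous
  have hc' : Continuous (deriv φ) := hφ.continuous_deriv le_rfl
  have hpos : ∀ t : ℝ, 0 < 1 + (t - p) ^ 2 := fun t => by positivity
  have hw : Continuous fun t : ℝ => 1 / (1 + (t - p) ^ 2) :=
    Continuous.div (by fun_prop) (by fun_prop) fun t => (hpos t).ne'
  have hw' : Continuous fun t : ℝ => (p - t) / (1 + (t - p) ^ 2) :=
    Continuous.div (by fun_prop) (by fun_prop) fun t => (hpos t).ne'
  have hlog : 0 < Real.log 2 := Real.log_pos one_lt_two
  set D := ∫ s in (p - 1)..p, (deriv φ s) ^ 2 with hD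
  set R := ∫ s in (p - 1)..p, 1 / (1 + (s - p) ^ 2) * (φ s) ^ 2 with hR
  have hD0 : 0 ≤ D := intervalIntegral.integral_nonneg (by linarith) fun s _ => sq_nonneg _
  set ε := 4 * C * Real.log 2 with hε
  have hε0 : 0 < ε := by positivity
  have hpt : ∀ t ∈ Icc (p - 1) p, 1 / (1 + (t - p) ^ 2) * (φ p) ^ 2 ≤
      (1 + ε) * (1 / (1 + (t - p) ^ 2) * (φ t) ^ 2) +
        (1 + 1 / ε) * D * ((p - t) / (1 + (t - p) ^ 2)) := by
    intro t ht
    have hinc : (φ p - φ t) ^ 2 ≤ (p - t) * D := by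
      refine (sq_sub_le_mul_integral_deriv_sq hφ ht.2).trans ?_
      gcongr
      · linarith [ht.2]
      · exact intervalIntegral.integral_mono_interval ht.1 ht.2 le_rfl
          (Filter.Eventually.of_forall fun s => sq_nonneg _)
          (Continuous.intervalIntegrable (by fun_prop) _ _)
    have hyoung : (φ p) ^ 2 ≤ (1 + ε) * (φ t) ^ 2 + (1 + 1 / ε) * (φ p - φ t) ^ 2 := by
      have : (1 + ε) * (φ t) ^ 2 + (1 + 1 / ε) * (φ p - φ t) ^ 2 - (φ p) ^ 2 =
          (ε * φ t - (φ p - φ t)) ^ 2 / ε := by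
        field_simp
        ring
      have : 0 ≤ (ε * φ t - (φ p - φ t)) ^ 2 / ε := by positivity
      linarith
    have hall : (φ p) ^ 2 ≤ (1 + ε) * (φ t) ^ 2 + (1 + 1 / ε) * ((p - t) * D) :=
      hyoung.trans (by gcongr)
    calc 1 / (1 + (t - p) ^ 2) * (φ p) ^ 2
        ≤ 1 / (1 + (t - p) ^ 2) * ((1 + ε) * (φ t) ^ 2 + (1 + 1 / ε) * ((p - t) * D)) :=
          mul_le_mul_of_nonneg_left hall (by positivity)
      _ = _ := by ring
  have hint := intervalIntegral.integral_mono_on (μ := volume) (a := p - 1) (b := p) (by linarith)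
    (Continuous.intervalIntegrable (by fun_prop) _ _)
    (Continuous.intervalIntegrable (by fun_prop) _ _) hpt
  rw [intervalIntegral.integral_add (Continuous.intervalIntegrable (by fun_prop) _ _)
    (Continuous.intervalIntegrable (by fun_prop) _ _), intervalIntegral.integral_mul_const,
    intervalIntegral.integral_const_mul, intervalIntegral.integral_const_mul,
    integral_inv_one_add_sq_sub, integral_sub_div_one_add_sq_sub, ← hR] at hint
  have hslack : (2 / (π * C) + 8 * Real.log 2 / π) * (D + 2 * C * R) -
      4 / π * ((1 + ε) * R + (1 + 1 / ε) * D * (Real.log 2 / 2)) =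
      (3 / (2 * π * C) + 6 * Real.log 2 / π) * D := by
    rw [hε]
    field_simp
    ring
  have hslack0 : 0 ≤ (3 / (2 * π * C) + 6 * Real.log 2 / π) * D := by positivity
  have hscale := mul_le_mul_of_nonneg_left hint (show 0 ≤ 4 / π by positivity)
  have hcancel : 4 / π * (π / 4 * (φ p) ^ 2) = (φ p) ^ 2 := by field_simp
  linarith

theorem stmt_1 (p a C E₁ : ℝ) (hpa : p ≤ a) (hC : 0 < C) (hE₁ : 0 < E₁)
    (K lmax : ℝ)
    (hK : K = 1 / (Real.pi * C) + 4 * Real.log 2 / Real.pi + (a - p))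
    (hlmax : lmax = -K + Real.sqrt (K ^ 2 + 1 / (4 * E₁))) :
    ∀ l : ℝ, 0 < l → l ≤ lmax →
      ∀ φ : ℝ → ℝ, ContDiff ℝ 1 φ →
        Integrable (fun s => (φ s) ^ 2) →
        Integrable (fun s => (deriv φ s) ^ 2) →
        (∫ s : ℝ, (deriv φ s) ^ 2) + 2 * C * (∫ s : ℝ, rho p s * (φ s) ^ 2)
          ≥ 4 * E₁ * ∫ s in a..(a + l), (φ s) ^ 2 := by
  intro l hl hle φ hφ hφi hφi'
  have hlog : 0 < Real.log 2 := Real.log_pos one_lt_two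
  have hc : Continuous φ := hφ.continuous
  have hc' : Continuous (deriv φ) := hφ.continuous_deriv le_rfl
  have hK0 : 0 < K := by
    have : 0 < 1 / (π * C) + 4 * Real.log 2 / π := by positivity
    linarith
  have hwindow : 4 * E₁ * (l ^ 2 + 2 * K * l) ≤ 1 := by
    have hsqrt : l + K ≤ √(K ^ 2 + 1 / (4 * E₁)) := by linarith
    have hsq := (Real.le_sqrt' (by linarith)).1 hsqrt
    have hdiv : l ^ 2 + 2 * K * l ≤ 1 / (4 * E₁) := by nlinarith
    rwa [le_div_iff₀ (by positivity), mul_comm] at hdiv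
  set M := 2 / (π * C) + 8 * Real.log 2 / π with hM
  have hM0 : 0 ≤ M := by positivity
  have hMK : M + 2 * (a - p) = 2 * K := by rw [hK, hM]; ring
  set D := ∫ s in (p - 1)..p, (deriv φ s) ^ 2 with hD
  set R := ∫ s in (p - 1)..p, 1 / (1 + (s - p) ^ 2) * (φ s) ^ 2 with hR
  set B := ∫ s in p..(a + l), (deriv φ s) ^ 2 with hB
  have hD0 : 0 ≤ D := intervalIntegral.integral_nonneg (by linarith) fun s _ => sq_nonneg _
  have hR0 : 0 ≤ R := intervalIntegral.integral_nonneg (by linarith) fun s _ => by positivity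
  have hB0 : 0 ≤ B := intervalIntegral.integral_nonneg (by linarith) fun s _ => sq_nonneg _
  have hDB : D + B ≤ ∫ s : ℝ, (deriv φ s) ^ 2 := by
    rw [hD, hB, intervalIntegral.integral_add_adjacent_intervals
      (Continuous.intervalIntegrable (by fun_prop) _ _)
      (Continuous.intervalIntegrable (by fun_prop) _ _),
      intervalIntegral.integral_of_le (by linarith)]
    exact setIntegral_le_integral hφi' (Filter.Eventually.of_forall fun s => sq_nonneg _)
  have hrho0 : ∀ s, 0 ≤ rho p s := fun s => by unfold rho; split_ifs <;> positivity
  have hrho1 : ∀ s, rho p s ≤ 1 := fun s => by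
    unfold rho
    split_ifs
    · rw [div_le_one (by positivity)]
      linarith [sq_nonneg (s - p)]
    · exact zero_le_one
  have hrhom : Measurable (rho p) :=
    Measurable.ite measurableSet_Iic (by fun_prop) measurable_const
  have hrhoi : Integrable fun s => rho p s * (φ s) ^ 2 := by
    refine hφi.mono' (hrhom.aestronglyMeasurable.mul hφi.aestronglyMeasurable)
      (Filter.Eventually.of_forall fun s => ?_)
    rw [Real.norm_of_nonneg (mul_nonneg (hrho0 s) (sq_nonneg _))]
    exact mul_le_of_le_one_left (sq_nonneg _) (hrho1 s)
  have hRle : R ≤ ∫ s : ℝ, rho p s * (φ s) ^ 2 := by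
    have hcongr : R = ∫ s in Ioc (p - 1) p, rho p s * (φ s) ^ 2 := by
      rw [hR, intervalIntegral.integral_of_le (by linarith)]
      exact setIntegral_congr_fun measurableSet_Ioc fun s hs => by simp [rho, hs.2]
    rw [hcongr]
    exact setIntegral_le_integral hrhoi
      (Filter.Eventually.of_forall fun s => mul_nonneg (hrho0 s) (sq_nonneg _))
  set Q := D + 2 * C * R + B with hQ
  have hQ0 : 0 ≤ Q := by positivity
  have hQle : Q ≤ (∫ s : ℝ, (deriv φ s) ^ 2) + 2 * C * ∫ s : ℝ, rho p s * (φ s) ^ 2 := by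
    have := mul_le_mul_of_nonneg_left hRle (show 0 ≤ 2 * C by positivity)
    linarith
  have hpt : ∀ s ∈ Icc a (a + l), (φ s) ^ 2 ≤ (M + (a + l - p)) * Q := by
    intro s hs
    have hps : p ≤ s := hpa.trans hs.1
    have hinc : (φ s - φ p) ^ 2 ≤ (a + l - p) * B := by
      refine (sq_sub_le_mul_integral_deriv_sq hφ hps).trans ?_
      have hmono : ∫ u in p..s, (deriv φ u) ^ 2 ≤ B :=
        intervalIntegral.integral_mono_interval le_rfl hps hs.2
          (Filter.Eventually.of_forall fun s => sq_nonneg _)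
          (Continuous.intervalIntegrable (by fun_prop) _ _)
      exact (mul_le_mul_of_nonneg_left hmono (by linarith)).trans
        (mul_le_mul_of_nonneg_right (by linarith [hs.2]) hB0)
    have h := add_sq_le_mul_add hM0 (by linarith) (by positivity) hB0
      (sq_le_mul_energy hφ p hC) hinc
    rwa [add_sub_cancel] at h
  have hint : ∫ s in a..(a + l), (φ s) ^ 2 ≤ l * ((M + (a + l - p)) * Q) := by
    have h := intervalIntegral.integral_mono_on (μ := volume) (by linarith)
      (Continuous.intervalIntegrable (by fun_prop) _ _)
      (Continuous.intervalIntegrable (by fun_prop) _ _) hpt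
    rwa [intervalIntegral.integral_const, smul_eq_mul, add_sub_cancel_left] at h
  have hcoef : l * (M + (a + l - p)) ≤ l ^ 2 + 2 * K * l := by nlinarith
  calc 4 * E₁ * ∫ s in a..(a + l), (φ s) ^ 2
      ≤ 4 * E₁ * (l * ((M + (a + l - p)) * Q)) := by gcongr
    _ = 4 * E₁ * (l * (M + (a + l - p))) * Q := by ring
    _ ≤ 4 * E₁ * (l ^ 2 + 2 * K * l) * Q := by gcongr
    _ ≤ 1 * Q := by gcongr
    _ ≤ _ := by rw [one_mul]; exact hQle
end

section
/- Let p ∈ ℝ and let φ : ℝ → ℝ be continuously differentiable with φ and φ' square-integrable on ℝ. Then for every t ≥ p, |φ(t)|² ≤ (4/π) ∫_ℝ ρ(s)φ(s)² ds + ((8 ln 2)/π + 2(t − p)) ∫_ℝ |φ'(s)|² ds. -/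
open MeasureTheory Real Set

open Filter Topology

/-- The sine of `π / 2 + arctan y`, the antiderivative of `(1 + y²)⁻¹` vanishing at `-∞`. -/
lemma sin_pi_div_two_add_arctan (y : ℝ) : sin (π / 2 + arctan y) = 1 / √(1 + y ^ 2) := by
  rw [add_comm, sin_add_pi_div_two, cos_arctan]

lemma pi_div_two_add_arctan_pos (y : ℝ) : 0 < π / 2 + arctan y := by
  linarith [neg_pi_div_two_lt_arctan y]

lemma pi_div_two_add_arctan_le {y : ℝ} (hy : y ≤ 0) :
    π / 2 + arctan y ≤ π / 2 * (1 / √(1 + y ^ 2)) := by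
  have h0 : arctan y ≤ 0 := by simpa using arctan_strictMono.monotone hy
  have h := mul_le_sin (pi_div_two_add_arctan_pos y).le (by linarith)
  rw [sin_pi_div_two_add_arctan] at h
  calc π / 2 + arctan y = π / 2 * (2 / π * (π / 2 + arctan y)) := by
        field_simp
    _ ≤ _ := by gcongr

lemma tendsto_pi_div_two_add_arctan_atBot :
    Tendsto (fun y => π / 2 + arctan y) atBot (𝓝 0) := by
  simpa using (tendsto_nhds_of_tendsto_nhdsWithin tendsto_arctan_atBot).const_add (π / 2)

lemma integrableOn_sq_pi_div_two_add_arctan :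
    IntegrableOn (fun y => (π / 2 + arctan y) ^ 2) (Iic 0) := by
  refine Integrable.mono' ((integrable_inv_one_add_sq.const_mul ((π / 2) ^ 2)).integrableOn)
    (by fun_prop) ?_
  filter_upwards [ae_restrict_mem measurableSet_Iic] with y hy
  rw [norm_of_nonneg (sq_nonneg _)]
  calc (π / 2 + arctan y) ^ 2 ≤ (π / 2 * (1 / √(1 + y ^ 2))) ^ 2 :=
        pow_le_pow_left₀ (pi_div_two_add_arctan_pos y).le (pi_div_two_add_arctan_le hy) 2
    _ = (π / 2) ^ 2 * (1 + y ^ 2)⁻¹ := by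
        rw [mul_pow, one_div, inv_pow, sq_sqrt (by positivity)]

lemma log_sin_pi_div_two_add_arctan (y : ℝ) :
    log (sin (π / 2 + arctan y)) = -(log (1 + y ^ 2) / 2) := by
  rw [sin_pi_div_two_add_arctan, one_div, log_inv, log_sqrt (by positivity)]

lemma hasDerivAt_integral_log_sin {θ : ℝ} (h0 : 0 < θ) (hπ : θ < π) :
    HasDerivAt (fun u => ∫ x in (0 : ℝ)..u, log (sin x)) (log (sin θ)) θ := by
  refine intervalIntegral.integral_hasDerivAt_right intervalIntegrable_log_sin ?_ ?_
  · exact Measurable.stronglyMeasurable (by fun_prop) |>.stronglyMeasurableAtFilter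
  · exact continuous_sin.continuousAt.log (sin_pos_of_pos_of_lt_pi h0 hπ).ne'

lemma integral_sq_pi_div_two_add_arctan :
    ∫ y in Iic (0 : ℝ), (π / 2 + arctan y) ^ 2 = π * log 2 := by
  have hderiv : ∀ y ∈ Iic (0 : ℝ), HasDerivAt (fun y => (π / 2 + arctan y) ^ 2 * y
      - (π / 2 + arctan y) * log (1 + y ^ 2) - 2 * ∫ x in (0 : ℝ)..(π / 2 + arctan y), log (sin x))
      ((π / 2 + arctan y) ^ 2) y := by
    intro y hy
    have hpos : 0 < 1 + y ^ 2 := by positivity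
    have hθ : HasDerivAt (fun y => π / 2 + arctan y) (1 / (1 + y ^ 2)) y :=
      (hasDerivAt_arctan y).const_add _
    have hlog : HasDerivAt (fun y : ℝ => log (1 + y ^ 2)) (2 * y / (1 + y ^ 2)) y := by
      simpa using ((hasDerivAt_pow 2 y).const_add 1).log hpos.ne'
    have hG := (hasDerivAt_integral_log_sin (pi_div_two_add_arctan_pos y)
      (by linarith [arctan_lt_pi_div_two y])).comp y hθ
    rw [log_sin_pi_div_two_add_arctan] at hG
    have := (((hθ.pow 2).mul (hasDerivAt_id y)).sub (hθ.mul hlog)).sub (hG.const_mul 2)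
    refine this.congr_deriv ?_
    simp only [id, Pi.pow_apply]
    field_simp
    ring
  have hlim : Tendsto (fun y => (π / 2 + arctan y) ^ 2 * y
      - (π / 2 + arctan y) * log (1 + y ^ 2) - 2 * ∫ x in (0 : ℝ)..(π / 2 + arctan y), log (sin x))
      atBot (𝓝 (0 - 0 - 2 * 0)) := by
    have hT := tendsto_pi_div_two_add_arctan_atBot
    refine (Tendsto.sub ?_ ?_).sub (Tendsto.const_mul 2 ?_)
    · refine squeeze_zero_norm' ?_ (by simpa using hT.mul_const (π / 2))
      filter_upwards [eventually_le_atBot 0] with y hy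
      have hp := pi_div_two_add_arctan_pos y
      have hle := pi_div_two_add_arctan_le hy
      have hs : |y| ≤ √(1 + y ^ 2) := by
        rw [← sqrt_sq_eq_abs]; exact sqrt_le_sqrt (by linarith)
      have hs0 : 0 < √(1 + y ^ 2) := by positivity
      rw [norm_mul, norm_of_nonneg (sq_nonneg _), norm_eq_abs, sq, mul_assoc]
      refine mul_le_mul_of_nonneg_left ?_ hp.le
      calc (π / 2 + arctan y) * |y| ≤ π / 2 * (1 / √(1 + y ^ 2)) * √(1 + y ^ 2) := by gcongr
        _ = π / 2 := by field_simp
    · have hsl : Tendsto (fun y => π * |sin (π / 2 + arctan y) * log (sin (π / 2 + arctan y))|)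
          atBot (𝓝 0) := by
        have h1 : Tendsto (fun y => sin (π / 2 + arctan y)) atBot (𝓝 0) := by
          simpa [Function.comp_def] using (continuous_sin.tendsto 0).comp hT
        simpa using (((continuous_mul_log.tendsto 0).comp h1).abs).const_mul π
      refine squeeze_zero_norm' ?_ hsl
      filter_upwards [eventually_le_atBot 0] with y hy
      have hle := pi_div_two_add_arctan_le hy
      rw [log_sin_pi_div_two_add_arctan, abs_mul, abs_neg, abs_div, abs_two, norm_mul,
        norm_of_nonneg (pi_div_two_add_arctan_pos y).le, norm_eq_abs, sin_pi_div_two_add_arctan,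
        abs_of_nonneg (by positivity : (0 : ℝ) ≤ 1 / √(1 + y ^ 2))]
      calc _ ≤ π / 2 * (1 / √(1 + y ^ 2)) * |log (1 + y ^ 2)| := by gcongr
        _ = _ := by ring
    · have hc : Continuous fun u => ∫ x in (0 : ℝ)..u, log (sin x) :=
        intervalIntegral.continuous_primitive (fun _ _ => intervalIntegrable_log_sin) 0
      simpa [Function.comp_def] using (hc.tendsto 0).comp hT
  rw [integral_Iic_of_hasDerivAt_of_tendsto' hderiv integrableOn_sq_pi_div_two_add_arctan hlim]
  simp [integral_log_sin_zero_pi_div_two]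
  ring

/-- A product of two functions with integrable squares is integrable. -/
lemma integrable_mul_of_integrable_sq {μ : Measure ℝ} {f g : ℝ → ℝ}
    (hf : AEStronglyMeasurable f μ) (hg : AEStronglyMeasurable g μ)
    (hf2 : Integrable (fun x => f x ^ 2) μ) (hg2 : Integrable (fun x => g x ^ 2) μ) :
    Integrable (fun x => f x * g x) μ :=
  ((memLp_two_iff_integrable_sq hf).2 hf2).integrable_mul
    ((memLp_two_iff_integrable_sq hg).2 hg2)

/-- Integration by parts against `(1 + s²)⁻¹` on the negative half-line. -/
lemma pi_div_two_mul_eq_integral {ψ : ℝ → ℝ} (hψ : ContDiff ℝ 1 ψ)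
    (hψ2 : Integrable (fun s => ψ s ^ 2)) (hψ'2 : Integrable (fun s => deriv ψ s ^ 2)) :
    IntegrableOn (fun s => (1 + s ^ 2)⁻¹ * ψ s + (π / 2 + arctan s) * deriv ψ s) (Iic 0) ∧
    π / 2 * ψ 0 =
      ∫ s in Iic (0 : ℝ), ((1 + s ^ 2)⁻¹ * ψ s + (π / 2 + arctan s) * deriv ψ s) := by
  have hc : Continuous ψ := hψ.continuous
  have hc' : Continuous (deriv ψ) := hψ.continuous_deriv le_rfl
  have hd : ∀ s, HasDerivAt ψ (deriv ψ s) s := fun s =>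
    (hψ.differentiable one_ne_zero s).hasDerivAt
  have hρ2 : Integrable fun s : ℝ => ((1 + s ^ 2)⁻¹) ^ 2 := by
    refine integrable_inv_one_add_sq.mono' (by fun_prop) (.of_forall fun s => ?_)
    have h1 : (1 + s ^ 2)⁻¹ ≤ 1 := inv_le_one_of_one_le₀ (by nlinarith)
    have h0 : 0 ≤ (1 + s ^ 2)⁻¹ := by positivity
    rw [norm_of_nonneg (sq_nonneg _)]
    nlinarith
  have hint : IntegrableOn (fun s => (1 + s ^ 2)⁻¹ * ψ s + (π / 2 + arctan s) * deriv ψ s)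
      (Iic 0) :=
    (integrable_mul_of_integrable_sq (by fun_prop) (by fun_prop) hρ2 hψ2).integrableOn.add
      (integrable_mul_of_integrable_sq (by fun_prop) (by fun_prop)
        integrableOn_sq_pi_div_two_add_arctan hψ'2.integrableOn)
  have hψlim : Tendsto (fun s => ψ s ^ 2) atBot (𝓝 0) := by
    refine tendsto_zero_of_hasDerivAt_of_integrableOn_Iic (a := 0)
      (f' := fun s => 2 * (ψ s * deriv ψ s)) (fun s _ => ?_) ?_ hψ2.integrableOn
    · exact ((hd s).pow 2).congr_deriv (by simp; ring)
    · exact ((integrable_mul_of_integrable_sq (by fun_prop) (by fun_prop)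
        hψ2 hψ'2).const_mul 2).integrableOn
  have hψ0 : Tendsto ψ atBot (𝓝 0) := by
    have := hψlim.sqrt
    simp only [sqrt_sq_eq_abs, sqrt_zero] at this
    exact (tendsto_zero_iff_abs_tendsto_zero _).2 this
  refine ⟨hint, ?_⟩
  have h := integral_Iic_of_hasDerivAt_of_tendsto' (a := 0) (m := 0)
    (f := fun s => (π / 2 + arctan s) * ψ s) (fun s _ => ?_) hint ?_
  · rw [h]; simp
  · exact ((hasDerivAt_arctan' s).const_add (π / 2)).mul (hd s)
  · simpa using tendsto_pi_div_two_add_arctan_atBot.mul hψ0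

/-- The pointwise bound at distance `τ` to the right of a Hardy weight centred at `0`. -/
lemma sq_le_integral_inv_one_add_sq {ψ : ℝ → ℝ} (hψ : ContDiff ℝ 1 ψ)
    (hψ2 : Integrable (fun s => ψ s ^ 2)) (hψ'2 : Integrable (fun s => deriv ψ s ^ 2))
    {τ : ℝ} (hτ : 0 ≤ τ) :
    ψ τ ^ 2 ≤ 4 / π * (∫ s in Iic (0 : ℝ), (1 + s ^ 2)⁻¹ * ψ s ^ 2)
      + (8 * log 2 / π + 2 * τ) * ∫ s, deriv ψ s ^ 2 := by
  have hc : Continuous ψ := hψ.continuous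
  have hc' : Continuous (deriv ψ) := hψ.continuous_deriv le_rfl
  obtain ⟨hint, hparts⟩ := pi_div_two_mul_eq_integral hψ hψ2 hψ'2
  have hlog : 0 < log 2 := log_pos one_lt_two
  have hπ := pi_pos
  set c := ψ τ
  set L := 2 * log 2 + π * τ / 2 with hL
  have hLpos : 0 < L := by positivity
  have young : ∀ a b : ℝ, c * (a * b) ≤ L * b ^ 2 + c ^ 2 / (4 * L) * a ^ 2 := by
    intro a b
    have : L * b ^ 2 + c ^ 2 / (4 * L) * a ^ 2 - c * (a * b)
        = (2 * L * b - c * a) ^ 2 / (4 * L) := by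
      field_simp; ring
    have h2 : 0 ≤ (2 * L * b - c * a) ^ 2 / (4 * L) := by positivity
    linarith
  have iρψ : IntegrableOn (fun s => (1 + s ^ 2)⁻¹ * ψ s ^ 2) (Iic 0) := by
    refine (hψ2.mono' (by fun_prop) (.of_forall fun s => ?_)).integrableOn
    rw [norm_of_nonneg (by positivity)]
    exact mul_le_of_le_one_left (sq_nonneg _) (inv_le_one_of_one_le₀ (by nlinarith))
  have iρ : IntegrableOn (fun s : ℝ => c ^ 2 / 4 * (1 + s ^ 2)⁻¹) (Iic 0) :=
    (integrable_inv_one_add_sq.const_mul _).integrableOn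
  have iD : IntegrableOn (fun s => L * deriv ψ s ^ 2) (Iic 0) :=
    (hψ'2.const_mul _).integrableOn
  have iθ : IntegrableOn (fun s => c ^ 2 / (4 * L) * (π / 2 + arctan s) ^ 2) (Iic 0) :=
    integrableOn_sq_pi_div_two_add_arctan.const_mul _
  have hleft : c * (π / 2 * ψ 0) ≤ (∫ s in Iic (0 : ℝ), (1 + s ^ 2)⁻¹ * ψ s ^ 2)
      + c ^ 2 / 4 * (π / 2) + (L * (∫ s in Iic (0 : ℝ), deriv ψ s ^ 2)
      + c ^ 2 / (4 * L) * (π * log 2)) := by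
    calc c * (π / 2 * ψ 0) = ∫ s in Iic (0 : ℝ),
          c * ((1 + s ^ 2)⁻¹ * ψ s + (π / 2 + arctan s) * deriv ψ s) := by
          rw [hparts, integral_const_mul]
      _ ≤ ∫ s in Iic (0 : ℝ), (((1 + s ^ 2)⁻¹ * ψ s ^ 2 + c ^ 2 / 4 * (1 + s ^ 2)⁻¹)
          + (L * deriv ψ s ^ 2 + c ^ 2 / (4 * L) * (π / 2 + arctan s) ^ 2)) := by
          refine integral_mono (hint.const_mul c) ((iρψ.add iρ).add (iD.add iθ)) fun s => ?_
          have h1 := young (π / 2 + arctan s) (deriv ψ s)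
          have h2 : 0 ≤ (1 + s ^ 2)⁻¹ * (ψ s - c / 2) ^ 2 := by positivity
          dsimp only
          linarith
      _ = _ := by
          rw [integral_add (by exact iρψ.add iρ) (by exact iD.add iθ), integral_add iρψ iρ, integral_add iD iθ,
            integral_const_mul, integral_const_mul, integral_const_mul,
            integral_Iic_inv_one_add_sq, integral_sq_pi_div_two_add_arctan]
          simp
  have hright : c * (π / 2 * (c - ψ 0)) ≤ L * (∫ s in Ioc 0 τ, deriv ψ s ^ 2)
      + c ^ 2 / (4 * L) * (π / 2) ^ 2 * τ := by
    calc c * (π / 2 * (c - ψ 0)) = ∫ s in (0 : ℝ)..τ, c * (π / 2 * deriv ψ s) := by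
          rw [intervalIntegral.integral_const_mul, intervalIntegral.integral_const_mul,
            intervalIntegral.integral_deriv_eq_sub
              (fun x _ => hψ.differentiable one_ne_zero x) (hc'.intervalIntegrable _ _)]
      _ ≤ ∫ s in (0 : ℝ)..τ, (L * deriv ψ s ^ 2 + c ^ 2 / (4 * L) * (π / 2) ^ 2) :=
          intervalIntegral.integral_mono hτ (Continuous.intervalIntegrable (by fun_prop) _ _)
            (Continuous.intervalIntegrable (by fun_prop) _ _) fun s => young _ _
      _ = _ := by
          rw [intervalIntegral.integral_add (Continuous.intervalIntegrable (by fun_prop) _ _)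
            (Continuous.intervalIntegrable (by fun_prop) _ _),
            intervalIntegral.integral_const_mul, intervalIntegral.integral_of_le hτ]
          simp
          ring
  have hD : (∫ s in Iic (0 : ℝ), deriv ψ s ^ 2) + (∫ s in Ioc 0 τ, deriv ψ s ^ 2)
      ≤ ∫ s, deriv ψ s ^ 2 := by
    rw [← setIntegral_union (Iic_disjoint_Ioc le_rfl) measurableSet_Ioc
      hψ'2.integrableOn hψ'2.integrableOn]
    exact setIntegral_le_integral hψ'2 (.of_forall fun s => sq_nonneg _)
  have hLD := mul_le_mul_of_nonneg_left hD hLpos.le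
  have hcL : c ^ 2 / (4 * L) * (π * log 2) + c ^ 2 / (4 * L) * (π / 2) ^ 2 * τ
      = c ^ 2 * π / 8 := by
    have : π * log 2 + (π / 2) ^ 2 * τ = π / 2 * L := by rw [hL]; ring
    rw [mul_assoc, ← mul_add, this]
    field_simp
    ring
  set E := ∫ s in Iic (0 : ℝ), (1 + s ^ 2)⁻¹ * ψ s ^ 2
  set D := ∫ s, deriv ψ s ^ 2
  have hfin : c ^ 2 * (π / 4) ≤ E + L * D := by nlinarith
  calc c ^ 2 = 4 / π * (c ^ 2 * (π / 4)) := by field_simp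
    _ ≤ 4 / π * (E + L * D) := by gcongr
    _ = _ := by rw [hL]; field_simp; ring

theorem stmt_3 (p : ℝ) (φ : ℝ → ℝ) (hφ : ContDiff ℝ 1 φ)
    (hφ2 : Integrable (fun s => (φ s) ^ 2))
    (hφ'2 : Integrable (fun s => (deriv φ s) ^ 2)) :
    ∀ t : ℝ, p ≤ t →
      |φ t| ^ 2 ≤ (4 / Real.pi) * (∫ s : ℝ, rho p s * (φ s) ^ 2)
        + (8 * Real.log 2 / Real.pi + 2 * (t - p)) * ∫ s : ℝ, (deriv φ s) ^ 2 := by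
  intro t ht
  have hderiv : ∀ s, deriv (fun x => φ (x + p)) s = deriv φ (s + p) := fun s =>
    deriv_comp_add_const φ p s
  have h := sq_le_integral_inv_one_add_sq (ψ := fun s => φ (s + p)) (by fun_prop)
    (hφ2.comp_add_right p) (by simpa only [hderiv] using hφ'2.comp_add_right p)
    (sub_nonneg.2 ht)
  simp only [hderiv, sub_add_cancel] at h
  rw [integral_add_right_eq_self (fun s => deriv φ s ^ 2) p] at h
  have hρ : ∫ s, rho p s * φ s ^ 2 = ∫ s in Iic (0 : ℝ), (1 + s ^ 2)⁻¹ * φ (s + p) ^ 2 := by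
    rw [← integral_add_right_eq_self _ p, ← integral_indicator measurableSet_Iic]
    congr 1 with s
    by_cases hs : s ≤ 0 <;> simp [rho, hs]
  rw [sq_abs, hρ]
  exact h
end

section
/- Let p, a ∈ ℝ with p ≤ a, let C > 0 and l > 0, and set c'' := 2l(1/(πC) + (4 ln 2)/π + (a − p)) + l². Then for every continuously differentiable φ : ℝ → ℝ with φ and φ' square-integrable on ℝ, ∫_a^{a+l} |φ(t)|² dt ≤ c'' · ∫_ℝ ( 2C ρ(s) φ(s)² + |φ'(s)|² ) ds. -/
open MeasureTheory Real Set

lemma rho_nonneg (p s : ℝ) : 0 ≤ rho p s := by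
  unfold rho; split_ifs <;> positivity

lemma rho_le_one (p s : ℝ) : rho p s ≤ 1 := by
  unfold rho
  split_ifs
  · rw [div_le_one (by positivity)]
    nlinarith [sq_nonneg (s - p)]
  · exact zero_le_one

lemma measurable_rho (p : ℝ) : Measurable (rho p) := by
  unfold rho
  exact Measurable.ite measurableSet_Iic (by fun_prop) measurable_const

/-- A nonnegative integrable function takes arbitrarily small values on every left half-line. -/
lemma exists_le_lt_of_integrable {f : ℝ → ℝ} (hf : Integrable f) (p : ℝ) {ε : ℝ} (hε : 0 < ε) :
    ∃ s ≤ p, f s < ε := by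
  by_contra! h
  have hconst : IntegrableOn (fun _ : ℝ => ε) (Iic p) := by
    refine Integrable.mono' (hf.integrableOn (s := Iic p)) (by fun_prop) ?_
    filter_upwards [ae_restrict_mem measurableSet_Iic] with s hs
    rw [Real.norm_of_nonneg hε.le]
    exact h s hs
  rw [integrableOn_const_iff] at hconst
  simp [hε.ne'] at hconst

/-- If `h` is a subsolution of the Riccati equation `h' + h² = V`, then the increment of `h φ²`
is controlled by the energy `∫ (V φ² + φ'²)`. -/
lemma riccati_sub_le_integral {φ φ' h h' f : ℝ → ℝ} {u v : ℝ} (huv : u ≤ v)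
    (hφ : ∀ s, HasDerivAt φ (φ' s) s) (hh : ∀ s ∈ Icc u v, HasDerivAt h (h' s) s)
    (hf : IntegrableOn f (Icc u v))
    (hle : ∀ s ∈ Icc u v, (h' s + h s ^ 2) * φ s ^ 2 + φ' s ^ 2 ≤ f s) :
    h v * φ v ^ 2 - h u * φ u ^ 2 ≤ ∫ s in u..v, f s := by
  have hd : ∀ s ∈ Icc u v, HasDerivAt (fun s => h s * φ s ^ 2)
      (h' s * φ s ^ 2 + h s * (2 * φ s * φ' s)) s := fun s hs => by
    simpa using (hh s hs).fun_mul ((hφ s).fun_pow 2)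
  refine intervalIntegral.sub_le_integral_of_hasDeriv_right_of_le huv
    (fun s hs => (hd s hs).continuousAt.continuousWithinAt)
    (fun s hs => (hd s (Ioo_subset_Icc_self hs)).hasDerivWithinAt) hf fun s hs => ?_
  nlinarith [hle s (Ioo_subset_Icc_self hs), sq_nonneg (φ' s - h s * φ s)]

lemma coupling_bound {C : ℝ} (hC : 0 < C) {α : ℝ}
    (hα : α = (2 * (1 / (π * C) + 4 * Real.log 2 / π))⁻¹) : α + α ^ 2 ≤ 2 * C := by
  have hk := Real.log_two_gt_d9
  have hp := Real.pi_pos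
  have hp' := Real.pi_lt_d2
  set D := 1 + 4 * Real.log 2 * C with hD
  have hDpos : 0 < D := by positivity
  have hαD : α = π / 2 * C / D := by
    rw [hα, hD]; field_simp
  have hDC : 1 + 2.76 * C ≤ D := by rw [hD]; nlinarith
  have hα1 : α ≤ 1.575 * C / D := by
    rw [hαD]; gcongr; linarith
  have hα0 : 0 ≤ α := by rw [hαD]; positivity
  have hαD' : α * D ≤ 1.575 * C := (le_div_iff₀ hDpos).1 hα1
  have h1 : α * (1 + 2.76 * C) ≤ 1.575 * C := le_trans (by gcongr) hαD'
  nlinarith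

/-- Pointwise Hardy-type bound of `φ t ^ 2` by the weighted energy. -/
lemma sq_le_energy {p C : ℝ} (hC : 0 < C) {φ : ℝ → ℝ} (hφ : ContDiff ℝ 1 φ)
    (hi : Integrable (fun s => φ s ^ 2))
    (hf : Integrable (fun s => 2 * C * rho p s * φ s ^ 2 + deriv φ s ^ 2)) {t : ℝ} (ht : p ≤ t) :
    φ t ^ 2 ≤ (2 * (1 / (π * C) + 4 * Real.log 2 / π) + (t - p)) *
      ∫ s, (2 * C * rho p s * φ s ^ 2 + deriv φ s ^ 2) := by
  set K := 2 * (1 / (π * C) + 4 * Real.log 2 / π)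
  set f : ℝ → ℝ := fun s => 2 * C * rho p s * φ s ^ 2 + deriv φ s ^ 2 with hfdef
  have hf0 : ∀ s, 0 ≤ f s := fun s => by
    have := rho_nonneg p s
    positivity
  have hKpos : 0 < K := by
    have := Real.log_pos one_lt_two
    have := Real.pi_pos
    positivity
  have hφ' : ∀ s, HasDerivAt φ (deriv φ s) s := fun s =>
    (hφ.differentiable one_ne_zero s).hasDerivAt
  have hbound := coupling_bound hC (α := K⁻¹) rfl
  have hα : 0 < K⁻¹ := inv_pos.2 hKpos
  set α := K⁻¹
  have hright : (K + (t - p))⁻¹ * φ t ^ 2 - α * φ p ^ 2 ≤ ∫ s in p..t, f s := by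
    have := riccati_sub_le_integral (h := fun s => (K + (s - p))⁻¹)
      (h' := fun s => -1 / (K + (s - p)) ^ 2) (f := f) ht hφ' (fun s hs => ?_)
      hf.integrableOn (fun s hs => ?_)
    · simpa using this
    · have h0 : K + (s - p) ≠ 0 := by linarith [hs.1]
      exact (((hasDerivAt_id s).sub_const p).const_add K).inv h0
    · have h0 : -1 / (K + (s - p)) ^ 2 + ((K + (s - p))⁻¹) ^ 2 = 0 := by
        rw [inv_pow]; ring
      simp only [h0, hfdef]
      have := rho_nonneg p s
      have : 0 ≤ 2 * C * rho p s * φ s ^ 2 := by positivity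
      linarith
  have hleft : ∀ u ≤ p, α * φ p ^ 2 - α / (1 + (p - u)) * φ u ^ 2 ≤ ∫ s in u..p, f s := by
    intro u hu
    have := riccati_sub_le_integral (h := fun s => α / (1 + (p - s)))
      (h' := fun s => α / (1 + (p - s)) ^ 2) (f := f) hu hφ' (fun s hs => ?_)
      hf.integrableOn (fun s hs => ?_)
    · simpa using this
    · have h0 : 1 + (p - s) ≠ 0 := by linarith [hs.2]
      have := (hasDerivAt_const s α).fun_div (((hasDerivAt_id s).const_sub p).const_add 1) h0
      simpa using this
    · have hx : 0 ≤ p - s := by linarith [hs.2]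
      have hle : α / (1 + (p - s)) ^ 2 + (α / (1 + (p - s))) ^ 2 ≤ 2 * C * rho p s := by
        rw [rho, if_pos hs.2, div_pow, ← add_div, mul_one_div]
        refine div_le_div₀ (by positivity) hbound (by positivity) ?_
        nlinarith
      simp only [hfdef]
      gcongr
  have key : (K + (t - p))⁻¹ * φ t ^ 2 ≤ ∫ s, f s := by
    refine le_of_forall_pos_le_add fun ε hε => ?_
    obtain ⟨u, hu, hlt⟩ := exists_le_lt_of_integrable hi p (div_pos hε hα)
    have h1 := hleft u hu
    have h2 : α / (1 + (p - u)) * φ u ^ 2 ≤ ε := by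
      calc α / (1 + (p - u)) * φ u ^ 2 ≤ α * (ε / α) := by
            gcongr
            exact div_le_self hα.le (by linarith)
        _ = ε := by field_simp
    have h3 : (∫ s in u..p, f s) + ∫ s in p..t, f s = ∫ s in u..t, f s :=
      intervalIntegral.integral_add_adjacent_intervals hf.intervalIntegrable hf.intervalIntegrable
    have h4 : ∫ s in u..t, f s ≤ ∫ s, f s := by
      rw [intervalIntegral.integral_of_le (hu.trans ht)]
      exact setIntegral_le_integral hf (Filter.Eventually.of_forall hf0)
    linarith
  have hpos : 0 < K + (t - p) := by linarith
  rwa [inv_mul_le_iff₀ hpos] at key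

theorem stmt_5 (p a C l : ℝ) (hpa : p ≤ a) (hC : 0 < C) (hl : 0 < l)
    (c'' : ℝ)
    (hc'' : c'' = 2 * l * (1 / (Real.pi * C) + 4 * Real.log 2 / Real.pi + (a - p)) + l ^ 2) :
    ∀ φ : ℝ → ℝ, ContDiff ℝ 1 φ →
      Integrable (fun s => (φ s) ^ 2) →
      Integrable (fun s => (deriv φ s) ^ 2) →
      (∫ t in a..(a + l), (φ t) ^ 2)
        ≤ c'' * ∫ s : ℝ, (2 * C * rho p s * (φ s) ^ 2 + (deriv φ s) ^ 2) := by
  intro φ hφ hi hi'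
  have hf : Integrable (fun s => 2 * C * rho p s * φ s ^ 2 + deriv φ s ^ 2) := by
    refine Integrable.add ?_ hi'
    refine hi.bdd_mul (c := 2 * C) ((measurable_rho p).const_mul _).aestronglyMeasurable
      (Filter.Eventually.of_forall fun s => ?_)
    have := rho_nonneg p s
    rw [Real.norm_of_nonneg (by positivity)]
    exact mul_le_of_le_one_right (by positivity) (rho_le_one p s)
  set E := ∫ s : ℝ, (2 * C * rho p s * φ s ^ 2 + deriv φ s ^ 2)
  have hE0 : 0 ≤ E := integral_nonneg fun s => by
    have := rho_nonneg p s
    positivity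
  set K := 1 / (π * C) + 4 * Real.log 2 / π
  have hcont : Continuous fun t : ℝ => (2 * K + (t - p)) * E := by fun_prop
  calc ∫ t in a..(a + l), φ t ^ 2 ≤ ∫ t in a..(a + l), (2 * K + (t - p)) * E :=
        intervalIntegral.integral_mono_on (by linarith) hi.intervalIntegrable
          (hcont.intervalIntegrable _ _)
          fun t ht => sq_le_energy hC hφ hi hf (hpa.trans ht.1)
    _ = (2 * K * l + (a - p) * l + l ^ 2 / 2) * E := by
        have hcont' : Continuous fun t : ℝ => t - p := by fun_prop
        rw [intervalIntegral.integral_mul_const, intervalIntegral.integral_add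
          (by simp) (hcont'.intervalIntegrable _ _), intervalIntegral.integral_sub
          (by simp) (by simp)]
        simp only [intervalIntegral.integral_const, integral_id, smul_eq_mul]
        ring
    _ ≤ c'' * E := by
        gcongr
        rw [hc'']
        nlinarith [mul_nonneg (sub_nonneg.2 hpa) hl.le, sq_nonneg l]
end

section
/- Let p ∈ ℝ and r > 0, and define f : ℝ → ℝ by f(s) = 1 for s ≤ p − r, f(s) = (p − s)/r for p − r < s ≤ p, and f(s) = 0 for s > p. Then for every continuously differentiable h : ℝ → ℝ with h and h' square-integrable on (−∞, p), ∫_{−∞}^{p} h(s)²/(1+(s−p)²) ds ≤ 8 ∫_{−∞}^{p} ((f h)'(s))² ds + 2 ∫_{p−r}^{p} h(s)² ds, where (fh)' denotes the (almost everywhere defined) derivative of the product f·h. -/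
open MeasureTheory Real Set

/-- The cut-off function `f` used in the Hardy-inequality proof. -/
noncomputable def cutoff (p r : ℝ) (s : ℝ) : ℝ :=
  if s ≤ p - r then 1 else if s ≤ p then (p - s) / r else 0

/-- Hardy-type inequality on a half-line `(-∞, q]` away from the singular point `p`. -/
theorem setIntegral_Iic_hardy_le {p q : ℝ} (hq : q < p) {h : ℝ → ℝ} (hh : ContDiff ℝ 1 h)
    (h2 : IntegrableOn (fun s => (h s) ^ 2 / (1 + (s - p) ^ 2)) (Iic q))
    (hd : IntegrableOn (fun s => (deriv h s) ^ 2) (Iic q)) :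
    ∫ s in Iic q, (h s) ^ 2 / (1 + (s - p) ^ 2)
      ≤ 8 * (∫ s in Iic q, (deriv h s) ^ 2) + 4 * (h q) ^ 2 / (p - q) := by
  have hc : Continuous h := hh.continuous
  have hc' : Continuous (deriv h) := hh.continuous_deriv le_rfl
  have hden : ∀ s : ℝ, 1 + (s - p) ^ 2 ≠ 0 := fun s => by positivity
  have hi : IntegrableOn
      (fun s => 8 * (deriv h s) ^ 2 - (h s) ^ 2 / (1 + (s - p) ^ 2)) (Iic q) :=
    (hd.const_mul 8).sub h2
  have key : ∀ a ≤ q, -(4 * (h q) ^ 2 / (p - q)) ≤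
      ∫ s in a..q, (8 * (deriv h s) ^ 2 - (h s) ^ 2 / (1 + (s - p) ^ 2)) := by
    intro a ha
    have hne : ∀ s ∈ uIcc a q, p - s ≠ 0 := by
      intro s hs
      rw [uIcc_of_le ha] at hs
      linarith [hs.2]
    have hint : IntervalIntegrable
        (fun s => -(8 * h s * deriv h s / (p - s) + 4 * (h s) ^ 2 / (p - s) ^ 2)) volume a q := by
      apply ContinuousOn.intervalIntegrable
      refine ((ContinuousOn.div (by fun_prop) (by fun_prop) hne).add
        (ContinuousOn.div (by fun_prop) (by fun_prop) fun s hs => pow_ne_zero 2 (hne s hs))).neg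
    have ftc := intervalIntegral.integral_eq_sub_of_hasDerivAt
      (f := fun s => -(4 * (h s) ^ 2 / (p - s))) (a := a) (b := q) (f' := fun s =>
        -(8 * h s * deriv h s / (p - s) + 4 * (h s) ^ 2 / (p - s) ^ 2)) (fun s hs => by
          have e1 : HasDerivAt h (deriv h s) s := (hh.differentiable one_ne_zero s).hasDerivAt
          have e2 : HasDerivAt (fun s => p - s) (-1) s := (hasDerivAt_id s).const_sub p
          have hs0 := hne s hs
          refine (((e1.fun_pow 2).const_mul 4).fun_div e2 hs0).fun_neg.congr_deriv ?_
          push_cast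
          field_simp
          ring) hint
    have mono := intervalIntegral.integral_mono_on ha hint
      (g := fun s => 8 * (deriv h s) ^ 2 - (h s) ^ 2 / (1 + (s - p) ^ 2))
      (Continuous.intervalIntegrable (by fun_prop (disch := assumption)) a q) (fun s hs => by
        have hs0 : 0 < p - s := by linarith [hs.2]
        have hle : (h s) ^ 2 / (1 + (s - p) ^ 2) ≤ (h s) ^ 2 / (p - s) ^ 2 := by
          apply div_le_div_of_nonneg_left (sq_nonneg _) (by positivity)
          nlinarith
        have e : 8 * h s * deriv h s / (p - s) = 8 * deriv h s * (h s / (p - s)) := by ring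
        have e' : 4 * (h s) ^ 2 / (p - s) ^ 2 = 4 * (h s / (p - s)) ^ 2 := by
          rw [div_pow, mul_div_assoc]
        rw [← div_pow] at hle
        rw [e, e']
        nlinarith [sq_nonneg (2 * deriv h s + h s / (p - s)), sq_nonneg (h s / (p - s))])
    have hpos : 0 ≤ 4 * (h a) ^ 2 / (p - a) := div_nonneg (by positivity) (by linarith)
    rw [ftc] at mono
    linarith
  have lim := ge_of_tendsto
    (intervalIntegral_tendsto_integral_Iic q hi Filter.tendsto_id)
    ((Filter.eventually_le_atBot q).mono key)
  rw [integral_sub (hd.const_mul 8) h2, integral_const_mul] at lim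
  linarith

/-- Lower bound for the Dirichlet energy of `(p - s) / r * h s` on `(p - r, p)` by its value at
the left endpoint. -/
theorem le_setIntegral_Ioo_deriv_linear_mul_sq {p r : ℝ} (hr : 0 < r) {h : ℝ → ℝ}
    (hh : ContDiff ℝ 1 h) :
    4 * (h (p - r)) ^ 2 / r ≤
      8 * ∫ s in Ioo (p - r) p, (((p - s) * deriv h s - h s) / r) ^ 2 := by
  have hc : Continuous h := hh.continuous
  have hc' : Continuous (deriv h) := hh.continuous_deriv le_rfl
  have hle : p - r ≤ p := by linarith
  have hint : IntervalIntegrable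
      (fun s => -(4 * (2 * (p - s) * h s * deriv h s - (h s) ^ 2) / r ^ 2)) volume (p - r) p :=
    Continuous.intervalIntegrable (by fun_prop) _ _
  have ftc := intervalIntegral.integral_eq_sub_of_hasDerivAt
    (f := fun s => -(4 * ((p - s) * (h s) ^ 2) / r ^ 2)) (a := p - r) (b := p) (f' := fun s =>
      -(4 * (2 * (p - s) * h s * deriv h s - (h s) ^ 2) / r ^ 2)) (fun s _ => by
        have e1 : HasDerivAt h (deriv h s) s := (hh.differentiable one_ne_zero s).hasDerivAt
        have e2 : HasDerivAt (fun s => p - s) (-1) s := (hasDerivAt_id s).const_sub p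
        refine (((e2.fun_mul (e1.fun_pow 2)).const_mul 4).div_const
          (r ^ 2)).fun_neg.congr_deriv ?_
        push_cast
        ring) hint
  have mono := intervalIntegral.integral_mono_on hle hint
    (g := fun s => 8 * (((p - s) * deriv h s - h s) / r) ^ 2)
    (Continuous.intervalIntegrable (by fun_prop) _ _) (fun s _ => by
      rw [div_pow, ← mul_div_assoc, ← neg_div]
      apply div_le_div_of_nonneg_right _ (by positivity)
      nlinarith [sq_nonneg (2 * ((p - s) * deriv h s) - h s), sq_nonneg (h s)])
  rw [ftc, intervalIntegral.integral_const_mul, intervalIntegral.integral_of_le hle,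
    integral_Ioc_eq_integral_Ioo] at mono
  refine le_trans (le_of_eq ?_) mono
  field_simp
  ring

theorem deriv_cutoff_mul_of_lt {p r s : ℝ} (h : ℝ → ℝ) (hs : s < p - r) :
    deriv (fun u => cutoff p r u * h u) s = deriv h s := by
  apply Filter.EventuallyEq.deriv_eq
  filter_upwards [Iio_mem_nhds hs] with u hu
  simp [cutoff, le_of_lt (mem_Iio.mp hu)]

theorem deriv_cutoff_mul_of_mem_Ioo {p r s : ℝ} {h : ℝ → ℝ} (hh : DifferentiableAt ℝ h s)
    (hs : s ∈ Ioo (p - r) p) :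
    deriv (fun u => cutoff p r u * h u) s = ((p - s) * deriv h s - h s) / r := by
  have heq : (fun u => cutoff p r u * h u) =ᶠ[nhds s] fun u => (p - u) * h u / r := by
    filter_upwards [Ioo_mem_nhds hs.1 hs.2] with u hu
    simp only [cutoff, not_le.mpr hu.1, hu.2.le, if_true, if_false]
    ring
  rw [heq.deriv_eq]
  have e2 : HasDerivAt (fun s => p - s) (-1) s := (hasDerivAt_id s).const_sub p
  refine ((e2.mul hh.hasDerivAt).div_const r).deriv.trans ?_
  ring

theorem stmt_7 (p r : ℝ) (hr : 0 < r) :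
    ∀ h : ℝ → ℝ, ContDiff ℝ 1 h →
      IntegrableOn (fun s => (h s) ^ 2) (Set.Iio p) →
      IntegrableOn (fun s => (deriv h s) ^ 2) (Set.Iio p) →
      (∫ s in Set.Iio p, (h s) ^ 2 / (1 + (s - p) ^ 2))
        ≤ 8 * (∫ s in Set.Iio p, (deriv (fun u => cutoff p r u * h u) s) ^ 2)
          + 2 * ∫ s in Set.Ioo (p - r) p, (h s) ^ 2 := by
  intro h hh hi hd
  have hc : Continuous h := hh.continuous
  have hc' : Continuous (deriv h) := hh.continuous_deriv le_rfl
  have hlt : p - r < p := by linarith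
  have hden : ∀ s : ℝ, 1 + (s - p) ^ 2 ≠ 0 := fun s => by positivity
  have hle : ∀ s, (h s) ^ 2 / (1 + (s - p) ^ 2) ≤ (h s) ^ 2 := fun s =>
    div_le_self (sq_nonneg _) (by nlinarith [sq_nonneg (s - p)])
  have hw : IntegrableOn (fun s => (h s) ^ 2 / (1 + (s - p) ^ 2)) (Iio p) := by
    refine Integrable.mono' hi
      (Continuous.aestronglyMeasurable (by fun_prop (disch := assumption))) (.of_forall fun s => ?_)
    rw [Real.norm_of_nonneg (by positivity)]
    exact hle s
  have hunion : Iic (p - r) ∪ Ioo (p - r) p = Iio p := Iic_union_Ioo_eq_Iio hlt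
  have hdisj : Disjoint (Iic (p - r)) (Ioo (p - r) p) :=
    Set.disjoint_left.mpr fun s hs hs' => absurd hs'.1 (not_lt.mpr hs)
  have hsub₁ : Iic (p - r) ⊆ Iio p := hunion ▸ subset_union_left
  have hsub₂ : Ioo (p - r) p ⊆ Iio p := hunion ▸ subset_union_right
  have hae : (fun s => (deriv h s) ^ 2) =ᵐ[volume.restrict (Iic (p - r))]
      fun s => (deriv (fun u => cutoff p r u * h u) s) ^ 2 := by
    rw [← Measure.restrict_congr_set Iio_ae_eq_Iic]
    filter_upwards [ae_restrict_mem measurableSet_Iio] with s hs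
    rw [deriv_cutoff_mul_of_lt h hs]
  have heqOn : EqOn (fun s => (((p - s) * deriv h s - h s) / r) ^ 2)
      (fun s => (deriv (fun u => cutoff p r u * h u) s) ^ 2) (Ioo (p - r) p) := fun s hs => by
    simp only [deriv_cutoff_mul_of_mem_Ioo (hh.differentiable one_ne_zero s) hs]
  have hg₁ : IntegrableOn (fun s => (deriv (fun u => cutoff p r u * h u) s) ^ 2)
      (Iic (p - r)) := (hd.mono_set hsub₁).congr hae
  have hg₂ : IntegrableOn (fun s => (deriv (fun u => cutoff p r u * h u) s) ^ 2)
      (Ioo (p - r) p) := by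
    refine IntegrableOn.congr_fun ?_ heqOn measurableSet_Ioo
    exact (Continuous.integrableOn_Icc (by fun_prop)).mono_set Ioo_subset_Icc_self
  have far := setIntegral_Iic_hardy_le hlt hh (hw.mono_set hsub₁) (hd.mono_set hsub₁)
  have near := le_setIntegral_Ioo_deriv_linear_mul_sq (p := p) hr hh
  have bound := setIntegral_mono (hw.mono_set hsub₂) (hi.mono_set hsub₂) hle
  have hnonneg : 0 ≤ ∫ s in Ioo (p - r) p, (h s) ^ 2 := integral_nonneg fun s => sq_nonneg _
  rw [sub_sub_cancel, integral_congr_ae hae] at far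
  rw [setIntegral_congr_fun measurableSet_Ioo heqOn] at near
  rw [← hunion, setIntegral_union hdisj measurableSet_Ioo (hw.mono_set hsub₁) (hw.mono_set hsub₂),
    setIntegral_union hdisj measurableSet_Ioo hg₁ hg₂]
  linarith
end

section
/- Let ω ⊂ ℝ² be open, bounded and connected with smooth boundary, let E₁ > 0 satisfy the Poincaré inequality ∫_ω|∇v|²dt ≥ E₁∫_ω|v|²dt for every v ∈ C_c^∞(ω), let θ ∈ C_c¹(ℝ) with θ_m = inf supp θ' and θ_M = sup supp θ', let a ≥ θ_M, l > 0, and p ∈ (θ_m, θ_M). Assume: (i) there is C > 0 such that for every admissible ψ, ∫_{Ω₀}|∇'ψ|² + ∫_{Ω₀}|∂_sψ + θ'∂_τψ|² − ∫_{Ω₀} g(s)|ψ|² ≥ C∫_{Ω₀} ρ(s)|ψ|², where g(s) = 0 on (a,a+l) and g(s) = E₁ elsewhere; (ii) there is γ ∈ (0,1] such that for every admissible ψ, |2∫_{(θ_m,θ_M)×ω} ∂_sψ · θ'∂_τψ| ≤ γ(∫_{(θ_m,θ_M)×ω}|∇'ψ|² − E₁∫_{(θ_m,θ_M)×ω}|ψ|²)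 + (1/2)∫_{(θ_m,θ_M)×ω}|∂_sψ|² + (1/2)∫_{(θ_m,θ_M)×ω}|θ'∂_τψ|²; (iii) for every continuously differentiable φ : ℝ → ℝ with φ, φ' square-integrable, ∫_ℝ|φ'|² + 2C∫_ℝ ρ|φ|² ≥ 4E₁∫_a^{a+l}|φ|². Then for every admissible ψ, ∫_{Ω₀}( |∇'ψ|² + |∂_sψ + θ'∂_τψ|² ) ds dt ≥ E₁ ∫_{Ω₀} |ψ|² ds dt. -/
open MeasureTheory Real Set

/-- Longitudinal derivative `∂_s ψ` at `x = (s, t₂, t₃)`. -/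
noncomputable def dS (ψ : ℝ × ℝ × ℝ → ℝ) (x : ℝ × ℝ × ℝ) : ℝ :=
  deriv (fun u => ψ (u, x.2)) x.1

/-- Transverse derivative `∂_{t₂} ψ`. -/
noncomputable def dT2 (ψ : ℝ × ℝ × ℝ → ℝ) (x : ℝ × ℝ × ℝ) : ℝ :=
  deriv (fun u => ψ (x.1, u, x.2.2)) x.2.1

/-- Transverse derivative `∂_{t₃} ψ`. -/
noncomputable def dT3 (ψ : ℝ × ℝ × ℝ → ℝ) (x : ℝ × ℝ × ℝ) : ℝ :=
  deriv (fun u => ψ (x.1, x.2.1, u)) x.2.2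

/-- `|∇'ψ|²`, the squared transverse gradient. -/
noncomputable def gradTsq (ψ : ℝ × ℝ × ℝ → ℝ) (x : ℝ × ℝ × ℝ) : ℝ :=
  (dT2 ψ x) ^ 2 + (dT3 ψ x) ^ 2

/-- The angular derivative `∂_τ ψ = t₂ ∂_{t₃} ψ − t₃ ∂_{t₂} ψ`. -/
noncomputable def dTau (ψ : ℝ × ℝ × ℝ → ℝ) (x : ℝ × ℝ × ℝ) : ℝ :=
  x.2.1 * dT3 ψ x - x.2.2 * dT2 ψ x

/-- `∂_{t₂} v` for a function on the cross-section. -/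
noncomputable def dV2 (v : ℝ × ℝ → ℝ) (t : ℝ × ℝ) : ℝ :=
  deriv (fun u => v (u, t.2)) t.1

/-- `∂_{t₃} v` for a function on the cross-section. -/
noncomputable def dV3 (v : ℝ × ℝ → ℝ) (t : ℝ × ℝ) : ℝ :=
  deriv (fun u => v (t.1, u)) t.2

/-- `|∇v|²` for a function on the cross-section. -/
noncomputable def gradVsq (v : ℝ × ℝ → ℝ) (t : ℝ × ℝ) : ℝ :=
  (dV2 v t) ^ 2 + (dV3 v t) ^ 2

/-- Angular derivative on the cross-section. -/
noncomputable def dTauV (v : ℝ × ℝ → ℝ) (t : ℝ × ℝ) : ℝ :=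
  t.1 * dV3 v t - t.2 * dV2 v t

/-- `v ∈ C_c^∞(ω)`. -/
def TestFun (ω : Set (ℝ × ℝ)) (v : ℝ × ℝ → ℝ) : Prop :=
  ContDiff ℝ (⊤ : ℕ∞) v ∧ HasCompactSupport v ∧ tsupport v ⊆ ω

/-- Admissible functions on `Ω₀ = ℝ × ω`: continuously differentiable on the closure of
`Ω₀`, square-integrable together with the first partial derivatives, and vanishing on the
Dirichlet part of the boundary, i.e. at `t ∈ ∂ω` for `s ∉ (a, a+l)`. -/
def Admissible (ω : Set (ℝ × ℝ)) (a l : ℝ) (ψ : ℝ × ℝ × ℝ → ℝ) : Prop :=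
  ContDiffOn ℝ 1 ψ ((Set.univ : Set ℝ) ×ˢ closure ω) ∧
  IntegrableOn (fun x => (ψ x) ^ 2) ((Set.univ : Set ℝ) ×ˢ ω) ∧
  IntegrableOn (fun x => (dS ψ x) ^ 2) ((Set.univ : Set ℝ) ×ˢ ω) ∧
  IntegrableOn (fun x => (dT2 ψ x) ^ 2) ((Set.univ : Set ℝ) ×ˢ ω) ∧
  IntegrableOn (fun x => (dT3 ψ x) ^ 2) ((Set.univ : Set ℝ) ×ˢ ω) ∧
  ∀ s t, t ∈ frontier ω → s ∉ Set.Ioo a (a + l) → ψ (s, t) = 0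

/-- The potential `g`: zero on the window interval, `E₁` elsewhere. -/
noncomputable def gpot (E₁ a l : ℝ) (s : ℝ) : ℝ := if s ∈ Set.Ioo a (a + l) then 0 else E₁

/-- The restriction of Lebesgue measure to a cylinder over `I` is a product measure. -/
lemma volume_restrict_cylinder (I : Set ℝ) (ω : Set (ℝ × ℝ)) :
    (volume : Measure (ℝ × ℝ × ℝ)).restrict (I ×ˢ ω)
      = (volume.restrict I).prod (volume.restrict ω) :=
  (Measure.prod_restrict I ω).symm

lemma volume_restrict_univ_cylinder (ω : Set (ℝ × ℝ)) :
    (volume : Measure (ℝ × ℝ × ℝ)).restrict (univ ×ˢ ω)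
      = (volume : Measure ℝ).prod (volume.restrict ω) := by
  rw [volume_restrict_cylinder, Measure.restrict_univ]

lemma measurable_gpot (E₁ a l : ℝ) : Measurable (gpot E₁ a l) :=
  Measurable.ite measurableSet_Ioo measurable_const measurable_const

lemma integrable_sq_of_hasCompactSupport {f : ℝ → ℝ} (hf : Continuous f)
    (hc : HasCompactSupport f) : Integrable fun s => f s ^ 2 := by
  have h : HasCompactSupport fun s => f s ^ 2 := by
    simp_rw [sq]
    exact hc.mul_right
  exact Continuous.integrable_of_hasCompactSupport (by fun_prop) h

/-- Slowly varying cut-offs supported in a left half-line. -/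
lemma exists_slow_cutoff (b : ℝ) {ε : ℝ} (hε : 0 < ε) :
    ∃ φ : ℝ → ℝ, ContDiff ℝ 1 φ ∧ HasCompactSupport φ ∧ (∀ s, b ≤ s → φ s = 0) ∧
      0 < (∫ s, φ s ^ 2) ∧ (∫ s, deriv φ s ^ 2) ≤ ε * ∫ s, φ s ^ 2 := by
  let f : ContDiffBump (0 : ℝ) := ⟨1, 2, one_pos, one_lt_two⟩
  have hf1 : ContDiff ℝ 1 (f : ℝ → ℝ) := f.contDiff
  have hI : 0 < ∫ s, f s ^ 2 := by
    rw [integral_pos_iff_support_of_nonneg (fun s => sq_nonneg _)]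
    · have : Function.support (fun s => f s ^ 2) = Metric.ball 0 2 := by
        rw [Function.support_pow _ two_ne_zero]; exact f.support_eq
      rw [this]
      exact Metric.measure_ball_pos _ _ two_pos
    · exact integrable_sq_of_hasCompactSupport f.continuous f.hasCompactSupport
  set A := ∫ s, f s ^ 2 with hA
  set B := ∫ s, deriv f s ^ 2 with hB
  have hB0 : 0 ≤ B := integral_nonneg fun s => sq_nonneg _
  obtain ⟨n, hn, hnB⟩ : ∃ n : ℝ, 1 ≤ n ∧ B ≤ ε * A * n :=
    ⟨max 1 (B / (ε * A)), le_max_left _ _, by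
      have := le_max_right 1 (B / (ε * A))
      rwa [div_le_iff₀ (by positivity), mul_comm] at this⟩
  have hn0 : 0 < n := by linarith
  let φ : ℝ → ℝ := fun s => f (s / n + (3 - b / n))
  have hint (h : ℝ → ℝ) : ∫ s, h (s / n + (3 - b / n)) = n * ∫ s, h s := by
    rw [Measure.integral_comp_div (fun y => h (y + (3 - b / n))) n, abs_of_pos hn0,
      integral_add_right_eq_self h, smul_eq_mul]
  have hderiv (s : ℝ) : deriv φ s = deriv f (s / n + (3 - b / n)) * (1 / n) := by
    have h1 : HasDerivAt (f : ℝ → ℝ) (deriv f (s / n + (3 - b / n))) (s / n + (3 - b / n)) :=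
      ((hf1.differentiable one_ne_zero) _).hasDerivAt
    exact (h1.comp s (((hasDerivAt_id s).div_const n).add_const _)).deriv
  have hφ2 : ∫ s, φ s ^ 2 = n * A := hint fun y => f y ^ 2
  have hφ'2 : ∫ s, deriv φ s ^ 2 = n * B * (1 / n) ^ 2 := by
    simp_rw [hderiv, mul_pow]
    rw [integral_mul_const, hint fun y => deriv f y ^ 2]
  refine ⟨φ, hf1.comp (by fun_prop), ?_, ?_, ?_, ?_⟩
  · refine HasCompactSupport.intro (isCompact_Icc (a := b - 5 * n) (b := b)) fun s hs => ?_
    refine f.zero_of_le_dist ?_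
    change 2 ≤ dist _ _
    rw [Real.dist_eq, sub_zero]
    by_contra! h
    rw [abs_lt] at h
    have e : s / n + (3 - b / n) = (s - b) / n + 3 := by ring
    rw [e] at h
    have h1 : (s - b) / n < -1 := by linarith
    have h2 : -5 < (s - b) / n := by linarith
    rw [div_lt_iff₀ hn0] at h1
    rw [lt_div_iff₀ hn0] at h2
    exact hs ⟨by linarith, by linarith⟩
  · intro s hs
    refine f.zero_of_le_dist ?_
    change 2 ≤ dist _ _
    have e : s / n + (3 - b / n) = (s - b) / n + 3 := by ring
    rw [Real.dist_eq, sub_zero, e]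
    have : 0 ≤ (s - b) / n := div_nonneg (by linarith) hn0.le
    rw [abs_of_nonneg (by linarith)]; linarith
  · rw [hφ2]; positivity
  · rw [hφ2, hφ'2]
    have e : n * B * (1 / n) ^ 2 = B / n := by field_simp
    rw [e, div_le_iff₀ hn0]
    nlinarith [mul_pos hε hI, mul_pos (mul_pos hε hI) hn0]

/-- The product `φ ⊗ v` of a `C¹` cut-off and a function on the cross-section that vanishes on
the boundary is admissible. -/
lemma admissible_mul {ω : Set (ℝ × ℝ)} (a l : ℝ) {φ : ℝ → ℝ} {v : ℝ × ℝ → ℝ}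
    (hφ : ContDiff ℝ 1 φ) (hφc : HasCompactSupport φ)
    (hv : ContDiffOn ℝ 1 v (closure ω)) (hv0 : ∀ t ∈ frontier ω, v t = 0)
    (hi : IntegrableOn (fun t => v t ^ 2) ω) (hi2 : IntegrableOn (fun t => dV2 v t ^ 2) ω)
    (hi3 : IntegrableOn (fun t => dV3 v t ^ 2) ω) :
    Admissible ω a l (fun x => φ x.1 * v x.2) := by
  have iφ : Integrable (fun s => φ s ^ 2) :=
    integrable_sq_of_hasCompactSupport hφ.continuous hφc
  have iφ' : Integrable (fun s => deriv φ s ^ 2) :=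
    integrable_sq_of_hasCompactSupport (hφ.continuous_deriv le_rfl) hφc.deriv
  refine ⟨?_, ?_, ?_, ?_, ?_, ?_⟩
  · exact (hφ.comp contDiff_fst).contDiffOn.mul (hv.comp contDiff_snd.contDiffOn fun x hx => hx.2)
  · simp_rw [IntegrableOn, volume_restrict_univ_cylinder, mul_pow]
    exact iφ.mul_prod hi
  · simp_rw [IntegrableOn, volume_restrict_univ_cylinder, dS, deriv_mul_const_field, mul_pow]
    exact iφ'.mul_prod hi
  · simp_rw [IntegrableOn, volume_restrict_univ_cylinder, dT2, deriv_const_mul_field, mul_pow]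
    exact iφ.mul_prod hi2
  · simp_rw [IntegrableOn, volume_restrict_univ_cylinder, dT3, deriv_const_mul_field, mul_pow]
    exact iφ.mul_prod hi3
  · intro s t ht _
    simp [hv0 t ht]

/-- A lower bound for the twisted waveguide form forces the Poincaré inequality on the
cross-section for all `C¹` functions vanishing on the boundary: test with `φ ⊗ v`, where `φ` is
slowly varying and supported to the left of the twist and of the window. -/
lemma poincare_of_form_nonneg {ω : Set (ℝ × ℝ)} {E₁ a l θm : ℝ} {θ : ℝ → ℝ}
    (hθ0 : ∀ s < θm, deriv θ s = 0) (ha : θm ≤ a)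
    (hform : ∀ ψ : ℝ × ℝ × ℝ → ℝ, Admissible ω a l ψ →
      0 ≤ (∫ x in (Set.univ : Set ℝ) ×ˢ ω, gradTsq ψ x)
        + (∫ x in (Set.univ : Set ℝ) ×ˢ ω, (dS ψ x + deriv θ x.1 * dTau ψ x) ^ 2)
        - (∫ x in (Set.univ : Set ℝ) ×ˢ ω, gpot E₁ a l x.1 * (ψ x) ^ 2))
    {v : ℝ × ℝ → ℝ}
    (hv : ContDiffOn ℝ 1 v (closure ω)) (hv0 : ∀ t ∈ frontier ω, v t = 0)
    (hi : IntegrableOn (fun t => v t ^ 2) ω) (hi2 : IntegrableOn (fun t => dV2 v t ^ 2) ω)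
    (hi3 : IntegrableOn (fun t => dV3 v t ^ 2) ω) :
    E₁ * (∫ t in ω, v t ^ 2) ≤ ∫ t in ω, gradVsq v t := by
  set B := ∫ t in ω, v t ^ 2 with hB
  set D := ∫ t in ω, gradVsq v t with hD
  have hB0 : 0 ≤ B := integral_nonneg fun t => sq_nonneg _
  have key : ∀ ε > 0, 0 ≤ D - E₁ * B + ε * B := by
    intro ε hε
    obtain ⟨φ, hφ, hφc, hφ0, hpos, hle⟩ := exists_slow_cutoff θm hε
    have h := hform _ (admissible_mul a l hφ hφc hv hv0 hi hi2 hi3)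
    have e1 (x : ℝ × ℝ × ℝ) :
        gradTsq (fun x => φ x.1 * v x.2) x = φ x.1 ^ 2 * gradVsq v x.2 := by
      simp only [gradTsq, dT2, dT3, deriv_const_mul_field, gradVsq, dV2, dV3]; ring
    have e2 (x : ℝ × ℝ × ℝ) : (dS (fun x => φ x.1 * v x.2) x
        + deriv θ x.1 * dTau (fun x => φ x.1 * v x.2) x) ^ 2
        = deriv φ x.1 ^ 2 * v x.2 ^ 2 := by
      have h0 : deriv θ x.1 * φ x.1 = 0 := by
        rcases lt_or_ge x.1 θm with h | h
        · rw [hθ0 _ h, zero_mul]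
        · rw [hφ0 _ h, mul_zero]
      have h1 : deriv θ x.1 * dTau (fun x => φ x.1 * v x.2) x = 0 := by
        have : deriv θ x.1 * dTau (fun x => φ x.1 * v x.2) x
            = deriv θ x.1 * φ x.1 * dTauV v x.2 := by
          simp only [dTau, dT2, dT3, deriv_const_mul_field, dTauV, dV2, dV3]; ring
        rw [this, h0, zero_mul]
      simp only [h1, add_zero, dS, deriv_mul_const_field, mul_pow]
    have e3 (x : ℝ × ℝ × ℝ) : gpot E₁ a l x.1 * (φ x.1 * v x.2) ^ 2
        = E₁ * (φ x.1 ^ 2 * v x.2 ^ 2) := by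
      rcases lt_or_ge x.1 θm with h | h
      · have : x.1 ∉ Ioo a (a + l) := fun hx => by linarith [hx.1]
        rw [gpot, if_neg this]; ring
      · rw [hφ0 _ h]; ring
    simp_rw [e1, e2, e3, volume_restrict_univ_cylinder] at h
    rw [integral_const_mul, integral_prod_mul (fun s => φ s ^ 2) (gradVsq v),
      integral_prod_mul (fun s => deriv φ s ^ 2) (fun t => v t ^ 2),
      integral_prod_mul (fun s => φ s ^ 2) (fun t => v t ^ 2), ← hB, ← hD] at h
    have h2 : 0 ≤ (∫ s, φ s ^ 2) * (D - E₁ * B + ε * B) := by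
      nlinarith [mul_le_mul_of_nonneg_right hle hB0]
    exact nonneg_of_mul_nonneg_right h2 hpos
  by_contra! hlt
  have hB1 : 0 < B + 1 := by linarith
  have h := key ((E₁ * B - D) / (B + 1)) (div_pos (by linarith) hB1)
  have h3 : (E₁ * B - D) / (B + 1) * B < E₁ * B - D := by
    rw [div_mul_eq_mul_div, div_lt_iff₀ hB1]; nlinarith
  linarith

section Regularity

variable {ψ : ℝ × ℝ × ℝ → ℝ}

lemma dS_eq_fderiv {x : ℝ × ℝ × ℝ} (h : DifferentiableAt ℝ ψ x) :
    dS ψ x = fderiv ℝ ψ x (1, 0) :=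
  (h.hasFDerivAt.comp_hasDerivAt_of_eq x.1
    ((hasDerivAt_id x.1).prodMk (hasDerivAt_const x.1 x.2)) rfl).deriv

lemma dT2_eq_fderiv {x : ℝ × ℝ × ℝ} (h : DifferentiableAt ℝ ψ x) :
    dT2 ψ x = fderiv ℝ ψ x (0, 1, 0) :=
  (h.hasFDerivAt.comp_hasDerivAt_of_eq x.2.1
    ((hasDerivAt_const x.2.1 x.1).prodMk
      ((hasDerivAt_id x.2.1).prodMk (hasDerivAt_const x.2.1 x.2.2))) rfl).deriv

lemma dT3_eq_fderiv {x : ℝ × ℝ × ℝ} (h : DifferentiableAt ℝ ψ x) :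
    dT3 ψ x = fderiv ℝ ψ x (0, 0, 1) :=
  (h.hasFDerivAt.comp_hasDerivAt_of_eq x.2.2
    ((hasDerivAt_const x.2.2 x.1).prodMk
      ((hasDerivAt_const x.2.2 x.2.1).prodMk (hasDerivAt_id x.2.2))) rfl).deriv

lemma continuousOn_partials {U : Set (ℝ × ℝ × ℝ)} (hU : IsOpen U) (hψ : ContDiffOn ℝ 1 ψ U) :
    ContinuousOn (dS ψ) U ∧ ContinuousOn (dT2 ψ) U ∧ ContinuousOn (dT3 ψ) U := by
  have hf := hψ.continuousOn_fderiv_of_isOpen hU le_rfl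
  have hd : ∀ x ∈ U, DifferentiableAt ℝ ψ x := fun x hx =>
    (hψ.differentiableOn one_ne_zero).differentiableAt (hU.mem_nhds hx)
  exact ⟨(hf.clm_apply continuousOn_const).congr fun x hx => dS_eq_fderiv (hd x hx),
    (hf.clm_apply continuousOn_const).congr fun x hx => dT2_eq_fderiv (hd x hx),
    (hf.clm_apply continuousOn_const).congr fun x hx => dT3_eq_fderiv (hd x hx)⟩

end Regularity

/-- A function with compact support vanishes outside the convex hull of its support. -/
lemma eq_zero_of_notMem_Icc_tsupport {f : ℝ → ℝ} (hf : HasCompactSupport f) {s : ℝ}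
    (hs : s ∉ Icc (sInf (tsupport f)) (sSup (tsupport f))) : f s = 0 := by
  by_contra h
  have hmem : s ∈ tsupport f := subset_tsupport f h
  exact hs ⟨csInf_le hf.isCompact.bddBelow hmem, le_csSup hf.isCompact.bddAbove hmem⟩

/-- A continuous function on the line vanishing off `[c, d]` vanishes off `(c, d)`. -/
lemma eq_zero_of_notMem_Ioo {f : ℝ → ℝ} (hf : Continuous f) {c d : ℝ}
    (h : ∀ s ∉ Icc c d, f s = 0) {s : ℝ} (hs : s ∉ Ioo c d) : f s = 0 := by
  have hcl : IsClosed {s | f s = 0} := isClosed_eq hf continuous_const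
  rcases not_and_or.mp hs with h1 | h1
  · have hsub : Iio c ⊆ {s | f s = 0} := fun y hy => h y fun hy' => not_le.mpr hy hy'.1
    have := closure_minimal hsub hcl
    rw [closure_Iio] at this
    exact this (not_lt.mp h1)
  · have hsub : Ioi d ⊆ {s | f s = 0} := fun y hy => h y fun hy' => not_le.mpr hy hy'.2
    have := closure_minimal hsub hcl
    rw [closure_Ioi] at this
    exact this (not_lt.mp h1)

lemma gpot_nonneg {E₁ : ℝ} (hE₁ : 0 ≤ E₁) (a l s : ℝ) : 0 ≤ gpot E₁ a l s := by
  unfold gpot; split_ifs <;> simp [hE₁]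

lemma gpot_le {E₁ : ℝ} (hE₁ : 0 ≤ E₁) (a l s : ℝ) : gpot E₁ a l s ≤ E₁ := by
  unfold gpot; split_ifs <;> simp [hE₁]

/-- Multiplying an integrable function on the waveguide by a bounded measurable function of the
longitudinal variable preserves integrability. -/
lemma integrable_longitudinal_mul {ω : Set (ℝ × ℝ)} {h : ℝ → ℝ} {f : ℝ × ℝ × ℝ → ℝ}
    (hh : Measurable h) {K : ℝ} (hK : ∀ s, |h s| ≤ K)
    (hf : IntegrableOn f (univ ×ˢ ω)) :
    IntegrableOn (fun x => h x.1 * f x) (univ ×ˢ ω) :=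
  Integrable.bdd_mul hf (hh.comp measurable_fst).aestronglyMeasurable
    (Filter.Eventually.of_forall fun x => hK x.1)

section Admissible

variable {ω : Set (ℝ × ℝ)} {a l : ℝ} {ψ : ℝ × ℝ × ℝ → ℝ}

lemma Admissible.integrable_gradTsq (hψ : Admissible ω a l ψ) :
    IntegrableOn (gradTsq ψ) (univ ×ˢ ω) :=
  hψ.2.2.2.1.add hψ.2.2.2.2.1

lemma Admissible.continuousOn_partials (hω : IsOpen ω) (hψ : Admissible ω a l ψ) :
    ContinuousOn (dS ψ) (univ ×ˢ ω) ∧ ContinuousOn (dT2 ψ) (univ ×ˢ ω) ∧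
      ContinuousOn (dT3 ψ) (univ ×ˢ ω) :=
  _root_.continuousOn_partials (isOpen_univ.prod hω)
    (hψ.1.mono (prod_mono le_rfl subset_closure))

/-- The twisting term `θ' ∂_τ ψ` is square-integrable on a bounded waveguide. -/
lemma Admissible.memLp_twist (hω : IsOpen ω) (hb : Bornology.IsBounded ω)
    (hψ : Admissible ω a l ψ) {h : ℝ → ℝ} (hh : Continuous h) (hc : HasCompactSupport h) :
    MemLp (fun x => h x.1 * dTau ψ x) 2 (volume.restrict (univ ×ˢ ω)) := by
  obtain ⟨K, hK⟩ := hc.exists_bound_of_continuous hh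
  obtain ⟨R, hR⟩ := hb.exists_norm_le
  obtain ⟨-, c2, c3⟩ := hψ.continuousOn_partials hω
  have hU : MeasurableSet ((univ : Set ℝ) ×ˢ ω) := (isOpen_univ.prod hω).measurableSet
  have m2 : MemLp (dT2 ψ) 2 (volume.restrict (univ ×ˢ ω)) :=
    (memLp_two_iff_integrable_sq (c2.aestronglyMeasurable hU)).2 hψ.2.2.2.1
  have m3 : MemLp (dT3 ψ) 2 (volume.restrict (univ ×ˢ ω)) :=
    (memLp_two_iff_integrable_sq (c3.aestronglyMeasurable hU)).2 hψ.2.2.2.2.1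
  have hbound {f c : ℝ × ℝ × ℝ → ℝ} (hf : MemLp f 2 (volume.restrict (univ ×ˢ ω)))
      (hcc : Continuous c) (hcR : ∀ x ∈ (univ : Set ℝ) ×ˢ ω, ‖c x‖ ≤ R) :
      MemLp (fun x => h x.1 * c x * f x) 2 (volume.restrict (univ ×ˢ ω)) := by
    have hm : Continuous fun x : ℝ × ℝ × ℝ => h x.1 * c x := by fun_prop
    refine hf.of_le_mul (c := K * R) (hm.aestronglyMeasurable.mul hf.1) ?_
    filter_upwards [ae_restrict_mem hU] with x hx
    rw [norm_mul, norm_mul]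
    exact mul_le_mul_of_nonneg_right (mul_le_mul (hK _) (hcR x hx) (norm_nonneg _)
      ((norm_nonneg _).trans (hK 0))) (norm_nonneg _)
  have h3 := hbound (c := fun x => x.2.1) m3 (by fun_prop)
    fun x hx => (norm_fst_le x.2).trans (hR _ hx.2)
  have h2 := hbound (c := fun x => x.2.2) m2 (by fun_prop)
    fun x hx => (norm_snd_le x.2).trans (hR _ hx.2)
  refine (h3.sub h2).ae_eq (Filter.Eventually.of_forall fun x => ?_)
  simp only [Pi.sub_apply, dTau]
  ring

lemma Admissible.contDiffOn_slice (hψ : Admissible ω a l ψ) (s : ℝ) :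
    ContDiffOn ℝ 1 (fun t => ψ (s, t)) (closure ω) :=
  hψ.1.comp (contDiff_prodMk_right s).contDiffOn fun _ ht => ⟨mem_univ _, ht⟩

lemma Admissible.contDiff_line (hψ : Admissible ω a l ψ) {t : ℝ × ℝ} (ht : t ∈ ω) :
    ContDiff ℝ 1 fun s => ψ (s, t) :=
  contDiffOn_univ.1 <| hψ.1.comp (contDiff_prodMk_left t).contDiffOn
    fun _ _ => ⟨mem_univ _, subset_closure ht⟩

/-- Integrated over almost every cross-section, the transverse energy dominates the potential. -/
lemma Admissible.ae_slice_nonneg {E₁ : ℝ} (hψ : Admissible ω a l ψ)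
    (hP : ∀ v : ℝ × ℝ → ℝ, ContDiffOn ℝ 1 v (closure ω) → (∀ t ∈ frontier ω, v t = 0) →
      IntegrableOn (fun t => v t ^ 2) ω → IntegrableOn (fun t => dV2 v t ^ 2) ω →
      IntegrableOn (fun t => dV3 v t ^ 2) ω →
      E₁ * (∫ t in ω, v t ^ 2) ≤ ∫ t in ω, gradVsq v t) :
    ∀ᵐ s, 0 ≤ ∫ t in ω, (gradTsq ψ (s, t) - gpot E₁ a l s * ψ (s, t) ^ 2) := by
  have hi := hψ.2.1
  have hi2 := hψ.2.2.2.1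
  have hi3 := hψ.2.2.2.2.1
  rw [IntegrableOn, volume_restrict_univ_cylinder] at hi hi2 hi3
  filter_upwards [hi.prod_right_ae, hi2.prod_right_ae, hi3.prod_right_ae] with s h1 h2 h3
  by_cases hs : s ∈ Ioo a (a + l)
  · refine integral_nonneg fun t => ?_
    simp only [gpot, if_pos hs, zero_mul, sub_zero, gradTsq, Pi.zero_apply]
    positivity
  · simp only [gpot, if_neg hs]
    have h := hP (fun t => ψ (s, t)) (hψ.contDiffOn_slice s)
      (fun t ht => hψ.2.2.2.2.2 s t ht hs) h1 h2 h3
    have hg : Integrable (fun t => gradTsq ψ (s, t)) (volume.restrict ω) := h2.add h3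
    rw [integral_sub hg (h1.const_mul E₁), integral_const_mul]
    exact sub_nonneg.2 h

/-- The one-dimensional inequality, integrated over the cross-section. -/
lemma Admissible.longitudinal_bound {E₁ C p : ℝ} (hω : IsOpen ω) (hE₁ : 0 < E₁) (hl : 0 < l)
    (hψ : Admissible ω a l ψ)
    (h1d : ∀ φ : ℝ → ℝ, ContDiff ℝ 1 φ →
      Integrable (fun s => (φ s) ^ 2) → Integrable (fun s => (deriv φ s) ^ 2) →
      (∫ s : ℝ, (deriv φ s) ^ 2) + 2 * C * (∫ s : ℝ, rho p s * (φ s) ^ 2)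
        ≥ 4 * E₁ * ∫ s in a..(a + l), (φ s) ^ 2) :
    4 * (E₁ * (∫ x in univ ×ˢ ω, ψ x ^ 2) - ∫ x in univ ×ˢ ω, gpot E₁ a l x.1 * ψ x ^ 2)
      ≤ (∫ x in univ ×ˢ ω, dS ψ x ^ 2) + 2 * C * ∫ x in univ ×ˢ ω, rho p x.1 * ψ x ^ 2 := by
  have hi := hψ.2.1
  have hiS := hψ.2.2.1
  have hig := integrable_longitudinal_mul (measurable_gpot E₁ a l) (K := E₁)
    (fun s => by rw [abs_of_nonneg (gpot_nonneg hE₁.le a l s)]; exact gpot_le hE₁.le a l s) hi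
  have hir := integrable_longitudinal_mul (measurable_rho p) (K := 1)
    (fun s => by rw [abs_of_nonneg (rho_nonneg p s)]; exact rho_le_one p s) hi
  rw [IntegrableOn, volume_restrict_univ_cylinder] at hi hiS hig hir
  have hiL : Integrable (fun x : ℝ × ℝ × ℝ => 4 * (E₁ * ψ x ^ 2 - gpot E₁ a l x.1 * ψ x ^ 2))
      (volume.prod (volume.restrict ω)) := ((hi.const_mul E₁).sub hig).const_mul 4
  have hiR : Integrable (fun x : ℝ × ℝ × ℝ => dS ψ x ^ 2 + 2 * C * (rho p x.1 * ψ x ^ 2))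
      (volume.prod (volume.restrict ω)) := hiS.add (hir.const_mul _)
  rw [volume_restrict_univ_cylinder, ← integral_const_mul, ← integral_sub (hi.const_mul E₁) hig,
    ← integral_const_mul, ← integral_const_mul, ← integral_add hiS (hir.const_mul _),
    integral_prod_symm _ hiL, integral_prod_symm _ hiR]
  refine integral_mono_ae hiL.integral_prod_right hiR.integral_prod_right ?_
  filter_upwards [hi.prod_left_ae, hiS.prod_left_ae, hir.prod_left_ae,
    ae_restrict_mem hω.measurableSet] with t h1 h2 h3 ht
  have h := h1d (fun s => ψ (s, t)) (hψ.contDiff_line ht) h1 h2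
  have e : ∫ s, (E₁ * ψ (s, t) ^ 2 - gpot E₁ a l s * ψ (s, t) ^ 2)
      = E₁ * ∫ s in a..(a + l), ψ (s, t) ^ 2 := by
    rw [intervalIntegral.integral_of_le (by linarith), integral_Ioc_eq_integral_Ioo,
      ← integral_const_mul, ← integral_indicator measurableSet_Ioo]
    refine integral_congr_ae (Filter.Eventually.of_forall fun s => ?_)
    by_cases hs : s ∈ Ioo a (a + l) <;> simp [gpot, hs]
  change ∫ s, 4 * (E₁ * ψ (s, t) ^ 2 - gpot E₁ a l s * ψ (s, t) ^ 2)
    ≤ ∫ s, (dS ψ (s, t) ^ 2 + 2 * C * (rho p s * ψ (s, t) ^ 2))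
  rw [integral_const_mul, e, integral_add h2 (h3.const_mul _), integral_const_mul]
  calc _ = 4 * E₁ * ∫ s in a..(a + l), ψ (s, t) ^ 2 := by ring
    _ ≤ _ := h

end Admissible

theorem stmt_11 (ω : Set (ℝ × ℝ)) (hω_open : IsOpen ω) (hω_bdd : Bornology.IsBounded ω)
    (hω_conn : IsConnected ω)
    (E₁ : ℝ) (hE₁ : 0 < E₁)
    (hPoincare : ∀ v : ℝ × ℝ → ℝ, TestFun ω v →
      (∫ t in ω, gradVsq v t) ≥ E₁ * ∫ t in ω, (v t) ^ 2)
    (θ : ℝ → ℝ) (hθ : ContDiff ℝ 1 θ) (hθc : HasCompactSupport θ)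
    (θm θM : ℝ) (hθm : θm = sInf (tsupport (deriv θ))) (hθM : θM = sSup (tsupport (deriv θ)))
    (a l : ℝ) (ha : θM ≤ a) (hl : 0 < l)
    (p : ℝ) (hp : p ∈ Set.Ioo θm θM)
    (C : ℝ) (hC : 0 < C)
    -- (i) the local Hardy inequality
    (hHardy : ∀ ψ : ℝ × ℝ × ℝ → ℝ, Admissible ω a l ψ →
      (∫ x in (Set.univ : Set ℝ) ×ˢ ω, gradTsq ψ x)
        + (∫ x in (Set.univ : Set ℝ) ×ˢ ω, (dS ψ x + deriv θ x.1 * dTau ψ x) ^ 2)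
        - (∫ x in (Set.univ : Set ℝ) ×ˢ ω, gpot E₁ a l x.1 * (ψ x) ^ 2)
      ≥ C * ∫ x in (Set.univ : Set ℝ) ×ˢ ω, rho p x.1 * (ψ x) ^ 2)
    (γ : ℝ) (hγ : γ ∈ Set.Ioc (0 : ℝ) 1)
    -- (ii) the mixed-term bound
    (hMixed : ∀ ψ : ℝ × ℝ × ℝ → ℝ, Admissible ω a l ψ →
      |2 * ∫ x in Set.Ioo θm θM ×ˢ ω, dS ψ x * (deriv θ x.1 * dTau ψ x)|
        ≤ γ * ((∫ x in Set.Ioo θm θM ×ˢ ω, gradTsq ψ x)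
              - E₁ * ∫ x in Set.Ioo θm θM ×ˢ ω, (ψ x) ^ 2)
          + (1 / 2) * (∫ x in Set.Ioo θm θM ×ˢ ω, (dS ψ x) ^ 2)
          + (1 / 2) * ∫ x in Set.Ioo θm θM ×ˢ ω, (deriv θ x.1 * dTau ψ x) ^ 2)
    -- (iii) positivity of the effective one-dimensional operator
    (h1d : ∀ φ : ℝ → ℝ, ContDiff ℝ 1 φ →
      Integrable (fun s => (φ s) ^ 2) → Integrable (fun s => (deriv φ s) ^ 2) →
      (∫ s : ℝ, (deriv φ s) ^ 2) + 2 * C * (∫ s : ℝ, rho p s * (φ s) ^ 2)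
        ≥ 4 * E₁ * ∫ s in a..(a + l), (φ s) ^ 2) :
    ∀ ψ : ℝ × ℝ × ℝ → ℝ, Admissible ω a l ψ →
      (∫ x in (Set.univ : Set ℝ) ×ˢ ω,
          (gradTsq ψ x + (dS ψ x + deriv θ x.1 * dTau ψ x) ^ 2))
        ≥ E₁ * ∫ x in (Set.univ : Set ℝ) ×ˢ ω, (ψ x) ^ 2 := by
  intro ψ hψ
  have hθ' : Continuous (deriv θ) := hθ.continuous_deriv le_rfl
  have hθ0 : ∀ s ∉ Ioo θm θM, deriv θ s = 0 := fun s hs =>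
    eq_zero_of_notMem_Ioo hθ' (fun s hs => eq_zero_of_notMem_Icc_tsupport hθc.deriv
      (by rwa [hθm, hθM] at hs)) hs
  have hρ0 : ∀ ψ : ℝ × ℝ × ℝ → ℝ, 0 ≤ ∫ x in (Set.univ : Set ℝ) ×ˢ ω, rho p x.1 * (ψ x) ^ 2 :=
    fun ψ => integral_nonneg fun x => mul_nonneg (rho_nonneg _ _) (sq_nonneg _)
  have hslice := hψ.ae_slice_nonneg (E₁ := E₁) fun v h1 h2 h3 h4 h5 =>
    poincare_of_form_nonneg (θ := θ) (θm := θm) (a := a) (l := l)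
      (fun s hs => hθ0 s fun h => not_lt.2 hs.le h.1) (by linarith [hp.1, hp.2])
      (fun ψ hψ => (mul_nonneg hC.le (hρ0 ψ)).trans (hHardy ψ hψ)) h1 h2 h3 h4 h5
  have hlong := hψ.longitudinal_bound hω_open hE₁ hl h1d
  have hHardy := hHardy ψ hψ
  have hMixed := hMixed ψ hψ
  have hU : MeasurableSet ((univ : Set ℝ) ×ˢ ω) := (isOpen_univ.prod hω_open).measurableSet
  have hJ : MeasurableSet (Ioo θm θM ×ˢ ω) := (isOpen_Ioo.prod hω_open).measurableSet
  have hsub : Ioo θm θM ×ˢ ω ⊆ (univ : Set ℝ) ×ˢ ω := prod_mono (subset_univ _) le_rfl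
  have iψ := hψ.2.1
  have iS := hψ.2.2.1
  have iG := hψ.integrable_gradTsq
  have mS : MemLp (dS ψ) 2 (volume.restrict (univ ×ˢ ω)) :=
    (memLp_two_iff_integrable_sq
      ((hψ.continuousOn_partials hω_open).1.aestronglyMeasurable hU)).2 iS
  have mT := hψ.memLp_twist hω_open hω_bdd hθ' hθc.deriv
  have iT : IntegrableOn (fun x => (deriv θ x.1 * dTau ψ x) ^ 2) (univ ×ˢ ω) := mT.integrable_sq
  have iST : IntegrableOn (fun x => dS ψ x * (deriv θ x.1 * dTau ψ x)) (univ ×ˢ ω) :=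
    mS.integrable_mul mT
  have iQ : IntegrableOn (fun x => (dS ψ x + deriv θ x.1 * dTau ψ x) ^ 2) (univ ×ˢ ω) :=
    (mS.add mT).integrable_sq
  have ig : IntegrableOn (fun x => gpot E₁ a l x.1 * ψ x ^ 2) (univ ×ˢ ω) :=
    integrable_longitudinal_mul (measurable_gpot E₁ a l) (K := E₁)
      (fun s => by rw [abs_of_nonneg (gpot_nonneg hE₁.le a l s)]; exact gpot_le hE₁.le a l s) iψ
  have iF : IntegrableOn (fun x => gradTsq ψ x - gpot E₁ a l x.1 * ψ x ^ 2) (univ ×ˢ ω) :=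
    iG.sub ig
  -- the transverse part on the twisted region
  have eJ : ∫ x in Ioo θm θM ×ˢ ω, (gradTsq ψ x - gpot E₁ a l x.1 * ψ x ^ 2)
      = (∫ x in Ioo θm θM ×ˢ ω, gradTsq ψ x) - E₁ * ∫ x in Ioo θm θM ×ˢ ω, ψ x ^ 2 := by
    rw [← integral_const_mul,
      ← integral_sub (iG.mono_set hsub) ((iψ.mono_set hsub).const_mul E₁)]
    refine setIntegral_congr_fun hJ fun x hx => ?_
    have : x.1 ∉ Ioo a (a + l) := fun h => by linarith [h.1, hx.1.2]
    simp only [gpot, if_neg this]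
  have eJ' : ∫ x in Ioo θm θM ×ˢ ω, (gradTsq ψ x - gpot E₁ a l x.1 * ψ x ^ 2)
      = ∫ s in Ioo θm θM, ∫ t in ω, (gradTsq ψ (s, t) - gpot E₁ a l s * ψ (s, t) ^ 2) := by
    have h := iF.mono_set hsub
    rw [IntegrableOn, volume_restrict_cylinder] at h
    rw [volume_restrict_cylinder, integral_prod _ h]
  have hA0 : 0 ≤ ∫ x in Ioo θm θM ×ˢ ω, (gradTsq ψ x - gpot E₁ a l x.1 * ψ x ^ 2) := by
    rw [eJ']
    exact integral_nonneg_of_ae (ae_restrict_of_ae hslice)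
  have hAle : ∫ x in Ioo θm θM ×ˢ ω, (gradTsq ψ x - gpot E₁ a l x.1 * ψ x ^ 2)
      ≤ ∫ x in univ ×ˢ ω, (gradTsq ψ x - gpot E₁ a l x.1 * ψ x ^ 2) := by
    have h := iF
    rw [IntegrableOn, volume_restrict_univ_cylinder] at h
    rw [eJ', volume_restrict_univ_cylinder, integral_prod _ h]
    exact setIntegral_le_integral h.integral_prod_left hslice
  have hSle : ∫ x in Ioo θm θM ×ˢ ω, dS ψ x ^ 2 ≤ ∫ x in univ ×ˢ ω, dS ψ x ^ 2 :=
    setIntegral_mono_set iS (Filter.Eventually.of_forall fun x => sq_nonneg _)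
      hsub.eventuallyLE
  have hTle : ∫ x in Ioo θm θM ×ˢ ω, (deriv θ x.1 * dTau ψ x) ^ 2
      ≤ ∫ x in univ ×ˢ ω, (deriv θ x.1 * dTau ψ x) ^ 2 :=
    setIntegral_mono_set iT (Filter.Eventually.of_forall fun x => sq_nonneg _)
      hsub.eventuallyLE
  have hT0 : 0 ≤ ∫ x in univ ×ˢ ω, (deriv θ x.1 * dTau ψ x) ^ 2 :=
    integral_nonneg fun x => sq_nonneg _
  have hST : ∫ x in Ioo θm θM ×ˢ ω, dS ψ x * (deriv θ x.1 * dTau ψ x)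
      = ∫ x in univ ×ˢ ω, dS ψ x * (deriv θ x.1 * dTau ψ x) := by
    refine (setIntegral_eq_of_subset_of_forall_sdiff_eq_zero hU hsub fun x hx => ?_).symm
    have : x.1 ∉ Ioo θm θM := fun h => hx.2 ⟨h, hx.1.2⟩
    rw [hθ0 _ this]; ring
  have hQ : ∫ x in univ ×ˢ ω, (dS ψ x + deriv θ x.1 * dTau ψ x) ^ 2
      = (∫ x in univ ×ˢ ω, dS ψ x ^ 2)
        + 2 * (∫ x in univ ×ˢ ω, dS ψ x * (deriv θ x.1 * dTau ψ x))
        + ∫ x in univ ×ˢ ω, (deriv θ x.1 * dTau ψ x) ^ 2 := by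
    have iSST : IntegrableOn (fun x => dS ψ x ^ 2 + 2 * (dS ψ x * (deriv θ x.1 * dTau ψ x)))
        (univ ×ˢ ω) := iS.add (iST.const_mul 2)
    rw [← integral_const_mul, ← integral_add iS (iST.const_mul 2), ← integral_add iSST iT]
    refine integral_congr_ae (Filter.Eventually.of_forall fun x => ?_)
    simp only
    ring
  rw [integral_sub iG ig] at hAle
  rw [← eJ, hST] at hMixed
  rw [integral_add iG iQ]
  have hγA := mul_le_mul_of_nonneg_right hγ.2 hA0
  have hmix := (abs_le.1 hMixed).1
  linarith
end
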